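/- Let V, Q be vector spaces of dimensions r and n−r, 𝓘=(I^1,…,I^s) an s-tuple of subsets of [n] each of cardinality r, and 𝓚=(K^1,…,K^s) an s-tuple of subsets of [r] each of cardinality d. There exists a nonempty open subset U of Fl(V)^s × Fl(Q)^s such that for all (𝓕,𝓖) ∈ U, every irreducible component (if nonempty) of the locally closed subset {φ ∈ Hom_𝓘(V,Q,𝓕,𝓖) : dim ker(φ)=d and ker(φ) ∈ ∩_{j=1}^{s} Ω°_{K^j}(F^j_•)} has dimension [dim(Gr(r,n)) − Σ_{j=1}^{s} codim(ω_{I^j})] + [dim(Gr(d,r)) − Σ_{j=1}^{s} codim(ω_{K^j})] + [Σ_{j=1}^{s} Σ_{a∈K^j}(n−r+a−i^j_a) − d(n−r)]. -/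

import Mathlib

noncomputable section

open Module Submodule

/-! ### Polynomial functions and the Zariski topology on a vector space -/

/-- Evaluation of a polynomial in linear functionals at a point of a vector space.
These are exactly the polynomial functions on a finite-dimensional vector space. -/
def mEval (k : Type*) {M : Type*} [Field k] [AddCommGroup M] [Module k M]
    (x : M) (p : MvPolynomial (Module.Dual k M) k) : k :=
  MvPolynomial.eval (fun l : Module.Dual k M => l x) p

/-- The Zariski topology on a (finite-dimensional) vector space, generated by the
complements of zero sets of polynomial functions. -/
def mZariski (k M : Type*) [Field k] [AddCommGroup M] [Module k M] :
    TopologicalSpace M :=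
  TopologicalSpace.generateFrom
    {U : Set M | ∃ p : MvPolynomial (Module.Dual k M) k, U = {x : M | mEval k x p ≠ 0}}

/-- The Zariski tangent space at a point `x` to a subset `A` of a vector space:
the common kernel of the differentials at `x` of all polynomial functions vanishing on `A`. -/
def mTangent (k : Type*) {M : Type*} [Field k] [AddCommGroup M] [Module k M]
    (A : Set M) (x : M) : Submodule k M :=
  letI := Classical.decEq (Module.Dual k M)
  ⨅ p ∈ {p : MvPolynomial (Module.Dual k M) k | ∀ a ∈ A, mEval k a p = 0},
    LinearMap.ker (∑ l ∈ p.vars, mEval k x (MvPolynomial.pderiv l p) • (l : Module.Dual k M))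

/-- `f : M → N` is a polynomial map on a subset `A ⊆ M`. -/
def IsPolyOn (k : Type*) {M N : Type*} [Field k] [AddCommGroup M] [Module k M]
    [AddCommGroup N] [Module k N] (A : Set M) (f : M → N) : Prop :=
  ∀ l : Module.Dual k N, ∃ p : MvPolynomial (Module.Dual k M) k, ∀ x ∈ A, l (f x) = mEval k x p

/-- Dimension (topological Krull dimension) of a subset of a topological space. -/
def subDim {α : Type*} (t : TopologicalSpace α) (C : Set α) : WithBot ℕ∞ :=
  @topologicalKrullDim C (TopologicalSpace.induced (Subtype.val : C → α) t)

/-- The irreducible components of a subset `A` of a topological space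
(for the subspace topology). -/
def subComponents {α : Type*} (t : TopologicalSpace α) (A : Set α) : Set (Set ↥A) :=
  @irreducibleComponents A (TopologicalSpace.induced (Subtype.val : A → α) t)

/-- Dimension of a subset `C` of a subspace `A` of a topological space. -/
def compDim {α : Type*} (t : TopologicalSpace α) (A : Set α) (C : Set ↥A) : WithBot ℕ∞ :=
  subDim (TopologicalSpace.induced (Subtype.val : A → α) t) C

/-! ### Flags, Schubert cells and Schubert varieties -/

/-- A complete flag on a finite-dimensional vector space, recorded as the increasing
function sending `m` to the `m`-th member (of dimension `m`) of the flag. -/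
def IsFlag {k M : Type*} [Field k] [AddCommGroup M] [Module k M]
    (E : ℕ → Submodule k M) : Prop :=
  Monotone E ∧ ∀ m : ℕ, finrank k ↥(E m) = min m (finrank k M)

/-- Membership of `V` in the (open) Schubert cell `Ω°_I(E_•) ⊆ Gr(r, M)` attached to the
subset `I ⊆ [n]` recorded by the strictly increasing tuple `i : Fin r → Fin n`
(`0`-indexed: the `1`-based subset is `{i a + 1}`): `dim (V ∩ E_u) = #{a | i_a ≤ u}`. -/
def cellMem {k M : Type*} [Field k] [AddCommGroup M] [Module k M] {n r : ℕ}
    (i : Fin r → Fin n) (E : ℕ → Submodule k M) (V : Submodule k M) : Prop :=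
  finrank k ↥V = r ∧
    ∀ u : ℕ, u ≤ n →
      finrank k ↥(V ⊓ E u) =
        (Finset.univ.filter (fun a : Fin r => (i a : ℕ) + 1 ≤ u)).card

/-- Membership of `V` in the (closed) Schubert variety `Ω_I(E_•) ⊆ Gr(r, M)`:
`dim (V ∩ E_{i_a}) ≥ a` for `a = 1, …, r`. -/
def varMem {k M : Type*} [Field k] [AddCommGroup M] [Module k M] {n r : ℕ}
    (i : Fin r → Fin n) (E : ℕ → Submodule k M) (V : Submodule k M) : Prop :=
  finrank k ↥V = r ∧ ∀ a : Fin r, (a : ℕ) + 1 ≤ finrank k ↥(V ⊓ E ((i a : ℕ) + 1))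

/-- The flag induced on a subspace `V` by a flag `E` on `M`: its `a`-th member is the
smallest subspace of the form `V ∩ E_u` of dimension `≥ a`. -/
def indSub {k M : Type*} [Field k] [AddCommGroup M] [Module k M]
    (E : ℕ → Submodule k M) (V : Submodule k M) : ℕ → Submodule k ↥V := fun a =>
  ⨅ u ∈ {u : ℕ | a ≤ finrank k ↥(Submodule.comap V.subtype (E u))},
    Submodule.comap V.subtype (E u)

/-- The flag induced on the quotient `M ⧸ V` by a flag `E` on `M`: its `b`-th member is
the smallest subspace of the form `(E_u + V)/V` of dimension `≥ b`. -/
def indQuot {k M : Type*} [Field k] [AddCommGroup M] [Module k M]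
    (E : ℕ → Submodule k M) (V : Submodule k M) : ℕ → Submodule k (M ⧸ V) := fun b =>
  ⨅ u ∈ {u : ℕ | b ≤ finrank k ↥(Submodule.map V.mkQ (E u))},
    Submodule.map V.mkQ (E u)

/-- The flag spanned by a tuple of vectors (a complete flag when the tuple is a basis). -/
def spanFlag (k : Type*) {M : Type*} [Field k] [AddCommGroup M] [Module k M] {r : ℕ}
    (b : Fin r → M) : ℕ → Submodule k M := fun m =>
  Submodule.span k (b '' {a : Fin r | (a : ℕ) < m})

/-- `P` holds for a generic point of `Fl(M)^s` (`r = dim M`): there is a nonempty Zariski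
open set of `s`-tuples of bases of `M` on which the associated tuples of complete flags
satisfy `P`. -/
def GenericFlags (k : Type*) {M : Type*} [Field k] [AddCommGroup M] [Module k M]
    (s r : ℕ) (P : (Fin s → ℕ → Submodule k M) → Prop) : Prop :=
  ∃ U : Set (Fin s → Fin r → M),
    @IsOpen _ (mZariski k (Fin s → Fin r → M)) U ∧
    (∃ b ∈ U, ∀ j, LinearIndependent k (b j)) ∧
    ∀ b ∈ U, (∀ j, LinearIndependent k (b j)) → P (fun j => spanFlag k (b j))

/-- `P` holds for a generic point of `Fl(M)^s × Fl(Q)^s` (`r = dim M`, `q = dim Q`). -/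
def GenericFlagPairs (k : Type*) {M Q : Type*} [Field k] [AddCommGroup M] [Module k M]
    [AddCommGroup Q] [Module k Q] (s r q : ℕ)
    (P : (Fin s → ℕ → Submodule k M) → (Fin s → ℕ → Submodule k Q) → Prop) : Prop :=
  ∃ U : Set ((Fin s → Fin r → M) × (Fin s → Fin q → Q)),
    @IsOpen _ (mZariski k ((Fin s → Fin r → M) × (Fin s → Fin q → Q))) U ∧
    (∃ b ∈ U, (∀ j, LinearIndependent k (b.1 j)) ∧ ∀ j, LinearIndependent k (b.2 j)) ∧
    ∀ b ∈ U, ((∀ j, LinearIndependent k (b.1 j)) ∧ ∀ j, LinearIndependent k (b.2 j)) →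
      P (fun j => spanFlag k (b.1 j)) (fun j => spanFlag k (b.2 j))

/-! ### The spaces `Hom_𝓘(V, Q, 𝓕, 𝓖)` -/

/-- The subspace `{φ : M →ₗ Q | φ(p) ⊆ q}` of `Hom(M, Q)`. -/
def homConstraint {k M Q : Type*} [Field k] [AddCommGroup M] [Module k M]
    [AddCommGroup Q] [Module k Q] (p : Submodule k M) (q : Submodule k Q) :
    Submodule k (M →ₗ[k] Q) :=
  LinearMap.ker ((LinearMap.llcomp k ↥p Q (Q ⧸ q) q.mkQ).comp (LinearMap.lcomp k Q p.subtype))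

/-- `Hom_𝓘(M, Q, F, G) = {φ | φ(F^j_a) ⊆ G^j_{i^j_a - a} for all a = 1, …, r, j = 1, …, s}`. -/
def homSpace {k M Q : Type*} [Field k] [AddCommGroup M] [Module k M]
    [AddCommGroup Q] [Module k Q] {n r s : ℕ} (I : Fin s → Fin r → Fin n)
    (F : Fin s → ℕ → Submodule k M) (G : Fin s → ℕ → Submodule k Q) :
    Submodule k (M →ₗ[k] Q) :=
  ⨅ j : Fin s, ⨅ a : Fin r,
    homConstraint (F j ((a : ℕ) + 1)) (G j ((I j a : ℕ) - (a : ℕ)))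

/-! ### Charts on the Grassmannian, tangent spaces to Schubert cells -/

/-- The graph of `ψ : V →ₗ C`, a point of the Grassmannian chart around `V`
determined by a complement `C` of `V`. -/
def graphMap {k M : Type*} [Field k] [AddCommGroup M] [Module k M]
    (V C : Submodule k M) (ψ : ↥V →ₗ[k] ↥C) : Submodule k M :=
  LinearMap.range (V.subtype + C.subtype ∘ₗ ψ)

/-- The canonical identification `Hom(V, C) ≃ Hom(V, M/V)` (derivative of the chart). -/
def conjMap {k M : Type*} [Field k] [AddCommGroup M] [Module k M]
    (V C : Submodule k M) : (↥V →ₗ[k] ↥C) →ₗ[k] (↥V →ₗ[k] M ⧸ V) :=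
  LinearMap.llcomp k ↥V ↥C (M ⧸ V) (V.mkQ ∘ₗ C.subtype)

/-- The tangent space at `V` to a set `S` of points of the Grassmannian `Gr(r, M)`,
computed in the chart determined by a complement `C` of `V` and viewed inside
`Hom(V, M/V)` via the canonical identification. -/
def grTangent {k M : Type*} [Field k] [AddCommGroup M] [Module k M]
    (S : Set (Submodule k M)) (V C : Submodule k M) :
    Submodule k (↥V →ₗ[k] (M ⧸ V)) :=
  Submodule.map (conjMap V C)
    (mTangent k {ψ : ↥V →ₗ[k] ↥C | graphMap V C ψ ∈ S} 0)

/-- The Zariski topology on the Grassmannian of `r`-dimensional subspaces of `M`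
(as a topology on `Submodule k M`), coinduced from the Stiefel parameterization by
spanning `r`-tuples. -/
def grTop (k : Type*) {M : Type*} [Field k] [AddCommGroup M] [Module k M] (r : ℕ) :
    TopologicalSpace (Submodule k M) :=
  TopologicalSpace.coinduced (fun b : Fin r → M => Submodule.span k (Set.range b))
    (mZariski k (Fin r → M))

/-! ### Numerical quantities -/

/-- `codim ω_I = ∑_{a=1}^r (n - r + a - i_a)` (as an integer). -/
def codimZ (n r : ℕ) (i : Fin r → Fin n) : ℤ :=
  ∑ a : Fin r, ((n : ℤ) - (r : ℤ) + ((a : ℕ) : ℤ) - ((i a : ℕ) : ℤ))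

/-- The quantity `∑_j ∑_{a ∈ K^j} (n - r + a - i^j_a) - d(n - r)` of Inequality `(†^𝓘_𝓚)`. -/
def daggerZ (n r d : ℕ) {s : ℕ} (I : Fin s → Fin r → Fin n)
    (K : Fin s → Fin d → Fin r) : ℤ :=
  (∑ j : Fin s, ∑ t : Fin d,
      ((n : ℤ) - (r : ℤ) + ((K j t : ℕ) : ℤ) - ((I j (K j t) : ℕ) : ℤ)))
    - (d : ℤ) * ((n : ℤ) - (r : ℤ))

/-- The expected dimension `dim(S, M, 𝓕) = d(m - d) - ∑_j ∑_{t=1}^d (m - d + t - k^j_t)`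
of an intersection of Schubert cells `Ω°_{K^j}` in `Gr(d, m)`. -/
def eDimZ {s : ℕ} (m d : ℕ) (K : Fin s → Fin d → Fin m) : ℤ :=
  (d : ℤ) * ((m : ℤ) - (d : ℤ)) -
    ∑ j : Fin s, ∑ t : Fin d,
      ((m : ℤ) - (d : ℤ) + ((t : ℕ) : ℤ) - ((K j t : ℕ) : ℤ))

/-- `codim ω_I` as a natural number. -/
def codimN (n r : ℕ) (i : Fin r → Fin n) : ℕ :=
  ∑ a : Fin r, ((n - r + (a : ℕ)) - (i a : ℕ))

/-! ### The cohomology ring of the Grassmannian, Schubert classes -/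

/-- The ideal `(h_{n-r+1}, …, h_n)` of the polynomial ring in `r` variables
(`h_m` the complete homogeneous symmetric polynomials). -/
def grassIdeal (r n : ℕ) : Ideal (MvPolynomial (Fin r) ℤ) :=
  Ideal.span ((fun m : ℕ => MvPolynomial.hsymm (Fin r) ℤ m) '' Set.Icc (n - r + 1) n)

/-- A presentation of the cohomology (Chow) ring `H^*(Gr(r,n))`: products of Schubert
classes vanish here exactly when they vanish in `H^*(Gr(r,n))`. -/
abbrev grassRing (r n : ℕ) : Type :=
  MvPolynomial (Fin r) ℤ ⧸ grassIdeal r n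

/-- `h_m` for an integer `m` (zero for negative `m`). -/
def hkZ (r : ℕ) (m : ℤ) : MvPolynomial (Fin r) ℤ :=
  if 0 ≤ m then MvPolynomial.hsymm (Fin r) ℤ m.toNat else 0

/-- The Schur polynomial (Jacobi–Trudi determinant) of the partition
`λ_a = n - r + a - i_a` attached to the subset `I ⊆ [n]` recorded by `i`. -/
def schurI {n r : ℕ} (i : Fin r → Fin n) : MvPolynomial (Fin r) ℤ :=
  Matrix.det (Matrix.of fun a b : Fin r =>
    hkZ r ((n : ℤ) - (r : ℤ) + ((b : ℕ) : ℤ) - ((i a : ℕ) : ℤ)))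

/-- The Schubert class `ω_I ∈ H^*(Gr(r,n))` of the subset `I ⊆ [n]` recorded by the
strictly increasing tuple `i : Fin r → Fin n`. -/
def omegaCls {n r : ℕ} (i : Fin r → Fin n) : grassRing r n :=
  Ideal.Quotient.mk (grassIdeal r n) (schurI i)

/-- The class of a point in `H^*(Gr(r,n))`: the Schubert class of `I = {1, …, r}`. -/
def pointCls (r n : ℕ) (h : r ≤ n) : grassRing r n :=
  omegaCls (fun a : Fin r => Fin.castLE h a)

/-! ### Schur polynomials of partitions, Littlewood–Richardson coefficients -/

/-- The Schur polynomial of a partition with at most `r` parts, via Jacobi–Trudi. -/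
def schurP {r : ℕ} (lam : Fin r → ℕ) : MvPolynomial (Fin r) ℤ :=
  Matrix.det (Matrix.of fun a b : Fin r =>
    hkZ r (((lam a : ℕ) : ℤ) - ((a : ℕ) : ℤ) + ((b : ℕ) : ℤ)))

/-- The Vandermonde alternant `a_δ = det(x_a^{r-1-b})`. -/
def alternant (r : ℕ) : MvPolynomial (Fin r) ℤ :=
  Matrix.det (Matrix.of fun a b : Fin r => (MvPolynomial.X a) ^ (r - 1 - (b : ℕ)))

/-- The coefficient of the Schur polynomial `s_δ` in a symmetric polynomial `f`
(in `r` variables): the coefficient of the monomial `x^{δ + (r-1, …, 1, 0)}` in `f ⬝ a_δ`. -/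
def schurCoeff (r : ℕ) (f : MvPolynomial (Fin r) ℤ) (δ : Fin r → ℕ) : ℤ :=
  MvPolynomial.coeff
    (Finsupp.equivFunOnFinite.symm (fun a : Fin r => δ a + (r - 1 - (a : ℕ))))
    (f * alternant r)

/-- The Littlewood–Richardson coefficient `c^λ_{μ,ν}` (partitions with at most `r` parts):
the multiplicity of `V_λ` in `V_μ ⊗ V_ν`, i.e. of `s_λ` in `s_μ s_ν`. -/
def lrCoeff (r : ℕ) (lam mu nu : Fin r → ℕ) : ℤ :=
  schurCoeff r (schurP mu * schurP nu) lam

/-- The multiplicity of `V_δ` in `V_{Λ 1} ⊗ ⋯ ⊗ V_{Λ t}` (as `GL(r)`-representations),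
i.e. of `s_δ` in `∏_j s_{Λ j}`. -/
def multiCoeff (r : ℕ) {t : ℕ} (Λ : Fin t → Fin r → ℕ) (δ : Fin r → ℕ) : ℤ :=
  schurCoeff r (∏ j : Fin t, schurP (Λ j)) δ

/-- `c` presents `X` as a subspace of an affine space with its Zariski topology. -/
structure IsZariskiCoord {k ι X : Type} [Field k] [TopologicalSpace X] (c : X → ι → k) : Prop where
  isOpen_ne : ∀ p : MvPolynomial ι k, IsOpen {x | MvPolynomial.eval (c x) p ≠ 0}
  exists_ne : ∀ U : Set X, IsOpen U → ∀ x ∈ U, ∃ p : MvPolynomial ι k,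
    MvPolynomial.eval (c x) p ≠ 0 ∧ ∀ y, MvPolynomial.eval (c y) p ≠ 0 → y ∈ U

namespace IsZariskiCoord

section

variable {k ι X : Type} [Field k] {c : X → ι → k}

/-- The ideal of polynomials vanishing on a set of points. -/
def van (c : X → ι → k) (Z : Set X) : Ideal (MvPolynomial ι k) :=
  MvPolynomial.vanishingIdeal k (c '' Z)

theorem mem_van {Z : Set X} {p : MvPolynomial ι k} :
    p ∈ van c Z ↔ ∀ x ∈ Z, MvPolynomial.eval (c x) p = 0 := by
  simp [van, MvPolynomial.mem_vanishingIdeal_iff, MvPolynomial.aeval_eq_eval]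

end

variable {k ι X : Type} [Field k] [TopologicalSpace X] {c : X → ι → k}

theorem subtype (h : IsZariskiCoord c) (A : Set X) :
    IsZariskiCoord (fun x : A => c x) where
  isOpen_ne p := (h.isOpen_ne p).preimage continuous_subtype_val
  exists_ne U hU x hx := by
    obtain ⟨V, hV, rfl⟩ := isOpen_induced_iff.1 hU
    obtain ⟨p, hp, hpV⟩ := h.exists_ne V hV x hx
    exact ⟨p, hp, fun y hy => hpV y hy⟩

theorem mem_closure_iff (h : IsZariskiCoord c) {Z : Set X} {y : X} :
    y ∈ closure Z ↔ ∀ p ∈ van c Z, MvPolynomial.eval (c y) p = 0 := by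
  rw [_root_.mem_closure_iff]
  constructor
  · intro H p hp
    by_contra hy
    obtain ⟨z, hz, hzZ⟩ := H _ (h.isOpen_ne p) hy
    exact hz (mem_van.1 hp z hzZ)
  · intro H U hU hy
    obtain ⟨p, hp, hpU⟩ := h.exists_ne U hU y hy
    by_contra hne
    refine hp (H p (mem_van.2 fun z hz => ?_))
    by_contra hpz
    exact hne ⟨z, hpU z hpz, hz⟩

theorem van_closure (h : IsZariskiCoord c) (Z : Set X) : van c (closure Z) = van c Z := by
  ext p
  refine ⟨fun hp => mem_van.2 fun x hx => mem_van.1 hp x (subset_closure hx), fun hp => ?_⟩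
  exact mem_van.2 fun x hx => h.mem_closure_iff.1 hx p hp

theorem isIrreducible_iff (h : IsZariskiCoord c) {Z : Set X} :
    IsIrreducible Z ↔ (van c Z).IsPrime := by
  constructor
  · rintro ⟨⟨z, hz⟩, hZ⟩
    refine ⟨fun htop => ?_, fun {p q} hpq => ?_⟩
    · have : (1 : MvPolynomial ι k) ∈ van c Z := htop ▸ Submodule.mem_top
      simpa using mem_van.1 this z hz
    · by_contra! hcon
      simp only [mem_van, not_forall] at hcon
      obtain ⟨⟨x, hx, hpx⟩, ⟨y, hy, hqy⟩⟩ := hcon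
      obtain ⟨w, hw, hpw, hqw⟩ := hZ _ _ (h.isOpen_ne p) (h.isOpen_ne q) ⟨x, hx, hpx⟩ ⟨y, hy, hqy⟩
      have := mem_van.1 hpq w hw
      rw [map_mul] at this
      exact (mul_ne_zero hpw hqw) this
  · intro hprime
    refine ⟨?_, ?_⟩
    · by_contra hne
      rw [Set.not_nonempty_iff_eq_empty] at hne
      exact hprime.ne_top (by rw [Ideal.eq_top_iff_one, mem_van]; simp [hne])
    · rintro U V hU hV ⟨x, hx, hxU⟩ ⟨y, hy, hyV⟩
      obtain ⟨p, hp, hpU⟩ := h.exists_ne U hU x hxU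
      obtain ⟨q, hq, hqV⟩ := h.exists_ne V hV y hyV
      by_contra hne
      have hpq : p * q ∈ van c Z := mem_van.2 fun z hz => by
        by_contra hz0
        rw [map_mul] at hz0
        exact hne ⟨z, hz, hpU z (left_ne_zero_of_mul hz0), hqV z (right_ne_zero_of_mul hz0)⟩
      rcases hprime.mem_or_mem hpq with h' | h'
      · exact hp (mem_van.1 h' x hx)
      · exact hq (mem_van.1 h' y hy)

theorem noetherianSpace [Finite ι] (h : IsZariskiCoord c) : TopologicalSpace.NoetherianSpace X := by
  have hmono : StrictMono fun U : TopologicalSpace.Opens X => van c (U : Set X)ᶜ := by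
    refine Monotone.strictMono_of_injective (fun U V hUV p hp => ?_) fun U V hUV => ?_
    · exact mem_van.2 fun x hx => mem_van.1 hp x fun hxU => hx (hUV hxU)
    · have key : ∀ W : TopologicalSpace.Opens X, ∀ x,
          x ∈ (W : Set X)ᶜ ↔ ∀ p ∈ van c (W : Set X)ᶜ, MvPolynomial.eval (c x) p = 0 := by
        intro W x
        rw [← h.mem_closure_iff, W.isOpen.isClosed_compl.closure_eq]
      ext x
      rw [← not_iff_not]
      have hUV' : van c (U : Set X)ᶜ = van c (V : Set X)ᶜ := hUV
      exact (key U x).trans (by rw [hUV']; exact (key V x).symm)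
  exact ⟨hmono.wellFoundedGT.wf⟩

end IsZariskiCoord

theorem trdeg_quotient_lt {k R : Type} [Field k] [CommRing R] [Algebra k R]
    [Algebra.FiniteType k R] {p q : Ideal R} [p.IsPrime] [q.IsPrime] (hpq : p < q) :
    Algebra.trdeg k (R ⧸ q) < Algebra.trdeg k (R ⧸ p) := by
  by_contra! hle
  let f : (R ⧸ p) →ₐ[k] (R ⧸ q) := Ideal.Quotient.factorₐ k hpq.le
  have hf : Function.Surjective f := Ideal.Quotient.factor_surjective hpq.le
  obtain ⟨a, haq, hap⟩ := SetLike.exists_of_lt hpq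
  obtain ⟨κ, x, hx⟩ := exists_isTranscendenceBasis' k (R ⧸ q)
  have hfin : Finite κ := by
    have := hx.lift_cardinalMk_eq_trdeg
    have hlt := trdeg_lt_aleph0_of_finiteType (R := k) (S := R ⧸ q)
    simp only [Cardinal.lift_id] at this
    rw [← this] at hlt
    exact Cardinal.lt_aleph0_iff_finite.1 hlt
  choose y hy using fun i => hf (x i)
  have hfy : (fun i => f (y i)) = x := funext hy
  have hyind : AlgebraicIndependent k y := by
    have h1 : AlgebraicIndependent k (f ∘ y) := by
      have := hx.1
      rwa [← hfy] at this
    exact AlgebraicIndependent.of_comp f h1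
  have hyb : IsTranscendenceBasis k y := by
    refine hyind.isTranscendenceBasis_of_lift_trdeg_le_of_finite ?_
    have := hx.lift_cardinalMk_eq_trdeg
    simp only [Cardinal.lift_id] at this ⊢
    rw [this]
    exact hle
  have halg := hyb.isAlgebraic
  have hane : (Ideal.Quotient.mk p a) ≠ 0 := by rwa [Ne, Ideal.Quotient.eq_zero_iff_mem]
  obtain ⟨r, hr, b, hb⟩ := (halg.isAlgebraic (Ideal.Quotient.mk p a)).exists_nonzero_dvd
    (mem_nonZeroDivisors_of_ne_zero hane)
  have hfa : f (Ideal.Quotient.mk p a) = 0 := by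
    change Ideal.Quotient.mk q a = 0
    rwa [Ideal.Quotient.eq_zero_iff_mem]
  have hfr : f (r : R ⧸ p) = 0 := by
    have hb' : (r : R ⧸ p) = Ideal.Quotient.mk p a * b := hb
    rw [hb', map_mul, hfa, zero_mul]
  obtain ⟨P, hP⟩ : (r : R ⧸ p) ∈ (MvPolynomial.aeval y : MvPolynomial κ k →ₐ[k] R ⧸ p).range := by
    rw [← Algebra.adjoin_range_eq_range_aeval]
    exact r.2
  have hPx : MvPolynomial.aeval x P = 0 := by
    rw [← hfy]
    rw [← MvPolynomial.comp_aeval_apply y f P]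
    have hP' : MvPolynomial.aeval y P = (r : R ⧸ p) := hP
    rw [hP', hfr]
  have hP0 : P = 0 := by
    have := (algebraicIndependent_iff.1 hx.1) P hPx
    exact this
  apply hr
  ext
  rw [← hP, hP0]
  simp

namespace IsZariskiCoord

variable {k ι X : Type} [Field k] [TopologicalSpace X] {c : X → ι → k}

theorem trdeg_quotient_van_lt {Z : Set X} (h : IsZariskiCoord c)
    (hZ : IsIrreducible Z) {m : ℕ}
    (H : ∀ J : Fin m → ι, ∃ R : MvPolynomial (Fin m) k, R ≠ 0 ∧
      ∀ x, MvPolynomial.eval (fun i => c x (J i)) R = 0) :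
    Algebra.trdeg k (MvPolynomial ι k ⧸ van c Z) < m := by
  have hprime := h.isIrreducible_iff.1 hZ
  by_contra! hle
  let x : ι → MvPolynomial ι k ⧸ van c Z := fun i => Ideal.Quotient.mk _ (MvPolynomial.X i)
  have haev : ∀ p, MvPolynomial.aeval x p = Ideal.Quotient.mk (van c Z) p := by
    intro p
    have := MvPolynomial.comp_aeval_apply (R := k) MvPolynomial.X (Ideal.Quotient.mkₐ k (van c Z)) p
    rw [MvPolynomial.aeval_X_left_apply] at this
    exact this.symm
  have htop : Algebra.adjoin k (Set.range x) = ⊤ := by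
    rw [Algebra.adjoin_range_eq_range_aeval, AlgHom.range_eq_top]
    intro y
    obtain ⟨p, rfl⟩ := Ideal.Quotient.mk_surjective y
    exact ⟨p, haev p⟩
  have : Algebra.IsAlgebraic (Algebra.adjoin k (Set.range x)) (MvPolynomial ι k ⧸ van c Z) := by
    refine ⟨fun y => ?_⟩
    have hy : y ∈ Algebra.adjoin k (Set.range x) := htop ▸ Algebra.mem_top
    exact isAlgebraic_algebraMap (A := MvPolynomial ι k ⧸ van c Z)
      (⟨y, hy⟩ : Algebra.adjoin k (Set.range x))
  have hnt : Nontrivial (MvPolynomial ι k ⧸ van c Z) := Ideal.Quotient.nontrivial_iff.2 hprime.ne_top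
  have hinj : FaithfulSMul k (MvPolynomial ι k ⧸ van c Z) :=
    (faithfulSMul_iff_algebraMap_injective _ _).2
      (algebraMap k (MvPolynomial ι k ⧸ van c Z)).injective
  obtain ⟨t, ht, hb⟩ := exists_isTranscendenceBasis_subset (R := k) (Set.range x)
  have hcard := hb.lift_cardinalMk_eq_trdeg
  simp only [Cardinal.lift_id] at hcard
  rw [← hcard, ← Cardinal.mk_fin] at hle
  obtain ⟨g⟩ : Nonempty (Fin m ↪ t) := (Cardinal.le_def _ _).1 hle
  have hex : ∀ i, ∃ j, x j = (g i : MvPolynomial ι k ⧸ van c Z) := fun i => ht (g i).2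
  choose J hJ using hex
  obtain ⟨R, hR, hRx⟩ := H J
  apply hR
  have hind := hb.1.comp g g.injective
  refine (algebraicIndependent_iff.1 hind) R ?_
  have h1 : (Subtype.val ∘ g : Fin m → MvPolynomial ι k ⧸ van c Z) = x ∘ J := by
    funext i; exact (hJ i).symm
  rw [h1, ← MvPolynomial.aeval_rename, haev, Ideal.Quotient.eq_zero_iff_mem, mem_van]
  intro y _
  rw [MvPolynomial.eval_rename]
  exact hRx y

theorem topologicalKrullDim_lt [Finite ι] (h : IsZariskiCoord c) {m : ℕ}
    (H : ∀ J : Fin m → ι, ∃ R : MvPolynomial (Fin m) k, R ≠ 0 ∧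
      ∀ x, MvPolynomial.eval (fun i => c x (J i)) R = 0) :
    topologicalKrullDim X < m := by
  have hlt : ∀ Z : TopologicalSpace.IrreducibleCloseds X,
      Algebra.trdeg k (MvPolynomial ι k ⧸ van c (Z : Set X)) < m := fun Z =>
    h.trdeg_quotient_van_lt Z.isIrreducible H
  have hnat : ∀ Z : TopologicalSpace.IrreducibleCloseds X,
      (Cardinal.toNat (Algebra.trdeg k (MvPolynomial ι k ⧸ van c (Z : Set X)))) < m := fun Z => by
    have := Cardinal.toNat_lt_toNat (hlt Z) (Cardinal.natCast_lt_aleph0)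
    simpa using this
  let f : TopologicalSpace.IrreducibleCloseds X → Fin m := fun Z => ⟨_, hnat Z⟩
  have hf : StrictMono f := by
    intro Z W hZW
    refine Cardinal.toNat_lt_toNat ?_ ((hlt W).trans Cardinal.natCast_lt_aleph0)
    have := h.isIrreducible_iff.1 Z.isIrreducible
    have := h.isIrreducible_iff.1 W.isIrreducible
    refine trdeg_quotient_lt (lt_of_le_of_ne ?_ ?_)
    · exact fun p hp => mem_van.2 fun x hx => mem_van.1 hp x (hZW.le hx)
    · intro heq
      refine hZW.not_ge fun x hx => ?_
      have hx' : x ∈ closure (Z : Set X) := by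
        rw [h.mem_closure_iff, ← heq]
        exact fun p hp => mem_van.1 hp x hx
      rwa [Z.isClosed.closure_eq] at hx'
  refine (Order.krullDim_le_of_strictMono f hf).trans_lt ?_
  rw [Order.krullDim_lt_coe_iff]
  intro l
  simpa using l.length_lt_card

end IsZariskiCoord

theorem height_vanishingIdeal_singleton {k ι : Type} [Field k] [IsAlgClosed k] [Finite ι]
    (a : ι → k) : (MvPolynomial.vanishingIdeal k {a} : Ideal (MvPolynomial ι k)).height
      = Nat.card ι := by
  have hdim : ringKrullDim (MvPolynomial ι k) = Nat.card ι := by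
    rw [MvPolynomial.ringKrullDim_of_isNoetherianRing, ringKrullDim_eq_zero_of_field, zero_add]
  have hfin : FiniteRingKrullDim (MvPolynomial ι k) := by
    rw [finiteRingKrullDim_iff_ne_bot_and_top, hdim]
    exact ⟨WithBot.coe_ne_bot, WithBot.coe_injective.ne (ENat.natCast_ne_top _)⟩
  obtain ⟨p, hp, hph⟩ := Ideal.exists_isMaximal_height (R := MvPolynomial ι k)
  obtain ⟨b, rfl⟩ := MvPolynomial.eq_vanishingIdeal_singleton_of_isMaximal k hp
  let τ : (ι → k) → MvPolynomial ι k →ₐ[k] MvPolynomial ι k := fun t =>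
    MvPolynomial.aeval fun i => MvPolynomial.X i + MvPolynomial.C (t i)
  have hτ : ∀ t u, u + t = 0 → (τ t).comp (τ u) = AlgHom.id k _ := by
    intro t u htu
    ext i
    have : u i + t i = 0 := congrFun htu i
    simp only [τ, AlgHom.comp_apply, MvPolynomial.aeval_X, map_add, AlgHom.id_apply,
      MvPolynomial.algHom_C, MvPolynomial.algebraMap_eq]
    rw [add_assoc, ← MvPolynomial.C_add, add_comm (t i), this, map_zero, add_zero]
  let e : MvPolynomial ι k ≃ₐ[k] MvPolynomial ι k :=
    AlgEquiv.ofAlgHom (τ (a - b)) (τ (b - a)) (hτ _ _ (by abel)) (hτ _ _ (by abel))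
  have hcomap : Ideal.comap (e : MvPolynomial ι k ≃+* MvPolynomial ι k)
      (MvPolynomial.vanishingIdeal k {b}) = MvPolynomial.vanishingIdeal k {a} := by
    ext p
    rw [Ideal.mem_comap, MvPolynomial.mem_vanishingIdeal_singleton_iff,
      MvPolynomial.mem_vanishingIdeal_singleton_iff]
    have : MvPolynomial.aeval b (e p) = MvPolynomial.aeval a p := by
      have : ((MvPolynomial.aeval b : MvPolynomial ι k →ₐ[k] k).comp (τ (a - b))) =
          MvPolynomial.aeval a := by
        ext i
        simp [τ]
      exact DFunLike.congr_fun this p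
    exact iff_of_eq (congrArg (· = 0) this)
  rw [← hcomap, RingEquiv.height_comap]
  rw [hdim] at hph
  exact WithBot.coe_injective hph

theorem IsZariskiCoord.card_le_topologicalKrullDim_add {k ι X : Type} [Field k] [IsAlgClosed k]
    [Finite ι] [TopologicalSpace X] {c : X → ι → k} (h : IsZariskiCoord c)
    (hc : Function.Surjective c) {A : Set X} {N : ℕ}
    (H : ∀ a ∈ A, ∃ (E : Set (MvPolynomial ι k)) (g : MvPolynomial ι k), E.encard ≤ N ∧
      (∀ f ∈ E, MvPolynomial.eval (c a) f = 0) ∧ MvPolynomial.eval (c a) g ≠ 0 ∧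
      ∀ x, MvPolynomial.eval (c x) g ≠ 0 → (∀ f ∈ E, MvPolynomial.eval (c x) f = 0) → x ∈ A)
    {C : Set A} (hC : C ∈ irreducibleComponents A) :
    (Nat.card ι : WithBot ℕ∞) ≤ topologicalKrullDim C + (N : WithBot ℕ∞) := by
  have hA := h.subtype A
  have hCc := hA.subtype C
  have := hA.noetherianSpace
  obtain ⟨U, hU, ⟨a, haU⟩, hUC⟩ :=
    TopologicalSpace.NoetherianSpace.exists_isOpen_nonempty_subset_irreducibleComponent C hC
  have hCcl : IsClosed C := isClosed_of_mem_irreducibleComponents C hC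
  obtain ⟨E, g, hEN, hEa, hga, hEA⟩ := H a a.2
  let M : Ideal (MvPolynomial ι k) := MvPolynomial.vanishingIdeal k {c a}
  have hmemM : ∀ p, p ∈ M ↔ MvPolynomial.eval (c a) p = 0 := fun p => by
    rw [MvPolynomial.mem_vanishingIdeal_singleton_iff, MvPolynomial.aeval_eq_eval]
  have hM : M.IsPrime := by
    refine ⟨fun htop => ?_, fun {p q} hpq => ?_⟩
    · have : (1 : MvPolynomial ι k) ∈ M := htop ▸ Submodule.mem_top
      simp [hmemM] at this
    · rw [hmemM, map_mul, mul_eq_zero] at hpq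
      exact hpq.imp (hmemM p).2 (hmemM q).2
  have hEM : E ⊆ M := fun f hf => (hmemM f).2 (hEa f hf)
  have hht := Ideal.height_le_height_add_encard_of_subset (p := M) E hEM
  rw [height_vanishingIdeal_singleton] at hht
  set π := Ideal.Quotient.mk (Ideal.span E) with hπ
  have hπs : Function.Surjective π := Ideal.Quotient.mk_surjective
  have hM' : (M.map π).IsPrime :=
    Ideal.map_isPrime_of_surjective hπs (by rw [hπ, Ideal.mk_ker]; exact Ideal.span_le.2 hEM)
  have hMcomap : (M.map π).comap π = M := by
    rw [Ideal.comap_map_of_surjective _ hπs, ← RingHom.ker_eq_comap_bot, hπ, Ideal.mk_ker,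
      sup_eq_left]
    exact Ideal.span_le.2 hEM
  let T : Ideal (MvPolynomial ι k) → Set X := fun q =>
    {x | (∀ p ∈ q, MvPolynomial.eval (c x) p = 0) ∧ MvPolynomial.eval (c x) g ≠ 0}
  -- the primes between `E` and `M`
  have hTA : ∀ q : Ideal (MvPolynomial ι k), E ⊆ q → T q ⊆ A := fun q hq x hx =>
    hEA x hx.2 fun f hf => hx.1 f (hq hf)
  have haT : ∀ q ≤ M, (a : X) ∈ T q := fun q hq => ⟨fun p hp => (hmemM p).1 (hq hp), hga⟩
  have hvan : ∀ q ≤ M, q.IsPrime → van c (T q) = q := by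
    intro q hq hqp
    refine le_antisymm (fun p hp => ?_) fun p hp => mem_van.2 fun x hx => hx.1 p hp
    have hpg : p * g ∈ q := by
      rw [← MvPolynomial.IsPrime.vanishingIdeal_zeroLocus (K := k) q,
        MvPolynomial.mem_vanishingIdeal_iff]
      intro y hy
      obtain ⟨x, rfl⟩ := hc y
      rw [MvPolynomial.aeval_eq_eval]
      by_cases hg : MvPolynomial.eval (c x) g = 0
      · rw [map_mul, hg, mul_zero]
      · rw [map_mul, mem_van.1 hp x ⟨fun p' hp' => ?_, hg⟩, zero_mul]
        have := (MvPolynomial.mem_zeroLocus_iff.1 hy) p' hp'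
        rwa [MvPolynomial.aeval_eq_eval] at this
    exact (hqp.mem_or_mem hpg).resolve_right fun hgq => hga ((hmemM g).1 (hq hgq))
  let TA : Ideal (MvPolynomial ι k) → Set A := fun q => Subtype.val ⁻¹' T q
  let TC : Ideal (MvPolynomial ι k) → Set C := fun q => Subtype.val ⁻¹' TA q
  have hvanA : ∀ q ≤ M, q.IsPrime → E ⊆ q → van (fun x : A => c x) (TA q) = q := by
    intro q hq hqp hEq
    rw [← hvan q hq hqp]
    ext p
    rw [hvan q hq hqp]
    nth_rewrite 2 [← hvan q hq hqp]
    simp only [mem_van]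
    exact ⟨fun hp x hx => hp ⟨x, hTA q hEq hx⟩ hx, fun hp x hx => hp x hx⟩
  have hTAC : ∀ q ≤ M, q.IsPrime → E ⊆ q → TA q ⊆ C := by
    intro q hq hqp hEq x hx
    have hirr : IsIrreducible (TA q) := hA.isIrreducible_iff.2 (by rwa [hvanA q hq hqp hEq])
    by_contra hxC
    obtain ⟨z, hz, hzU, hzC⟩ := hirr.2 U Cᶜ hU hCcl.isOpen_compl ⟨a, haT q hq, haU⟩ ⟨x, hx, hxC⟩
    exact hzC (hUC hzU)
  have hvanC : ∀ q ≤ M, q.IsPrime → E ⊆ q → van (fun x : C => c x.1) (TC q) = q := by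
    intro q hq hqp hEq
    ext p
    nth_rewrite 2 [← hvanA q hq hqp hEq]
    simp only [mem_van]
    exact ⟨fun hp x hx => hp ⟨x, hTAC q hq hqp hEq hx⟩ hx, fun hp x hx => hp x hx⟩
  have hle : ∀ q' : Set.Iic (⟨M.map π, hM'⟩ : PrimeSpectrum _), q'.1.asIdeal.comap π ≤ M :=
    fun q' => (Ideal.comap_mono q'.2).trans hMcomap.le
  have hEq : ∀ q' : PrimeSpectrum (MvPolynomial ι k ⧸ Ideal.span E),
      E ⊆ (q'.asIdeal.comap π : Ideal (MvPolynomial ι k)) := fun q' f hf => by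
    have : π f = 0 := Ideal.Quotient.eq_zero_iff_mem.2 (Ideal.subset_span hf)
    change π f ∈ q'.asIdeal
    rw [this]; exact zero_mem _
  have hpr : ∀ q' : PrimeSpectrum (MvPolynomial ι k ⧸ Ideal.span E),
      (q'.asIdeal.comap π : Ideal (MvPolynomial ι k)).IsPrime := fun q' => Ideal.comap_isPrime _ _
  let F : Set.Iic (⟨M.map π, hM'⟩ : PrimeSpectrum _) → (TopologicalSpace.IrreducibleCloseds C)ᵒᵈ :=
    fun q' => OrderDual.toDual ⟨closure (TC (q'.1.asIdeal.comap π)),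
      (hCc.isIrreducible_iff.2 (by
        rw [hvanC _ (hle q') (hpr q'.1) (hEq q'.1)]; exact hpr q'.1)).closure, isClosed_closure⟩
  have hF : StrictMono F := by
    intro q₁ q₂ h12
    have hvcl : ∀ q : Set.Iic (⟨M.map π, hM'⟩ : PrimeSpectrum _),
        van (fun x : C => c x.1) (closure (TC (q.1.asIdeal.comap π))) = q.1.asIdeal.comap π :=
      fun q => by rw [hCc.van_closure, hvanC _ (hle q) (hpr q.1) (hEq q.1)]
    refine lt_of_le_not_ge ?_ fun hge => ?_
    · refine closure_mono fun x hx => ⟨fun p hp => hx.1 p (Ideal.comap_mono h12.le hp), hx.2⟩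
    · refine h12.not_ge ?_
      have hge' : closure (TC (q₁.1.asIdeal.comap π)) ⊆ closure (TC (q₂.1.asIdeal.comap π)) := hge
      have : q₂.1.asIdeal.comap π ≤ q₁.1.asIdeal.comap π := by
        rw [← hvcl q₁, ← hvcl q₂]
        exact fun p hp => mem_van.2 fun x hx => mem_van.1 hp x (hge' hx)
      exact (Ideal.comap_le_comap_iff_of_surjective π hπs _ _).1 this
  have hdim := Order.krullDim_le_of_strictMono F hF
  rw [Order.krullDim_orderDual, ← Order.height_eq_krullDim_Iic] at hdim
  have hh : (M.map π).height = Order.height (⟨M.map π, hM'⟩ : PrimeSpectrum _) :=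
    PrimeSpectrum.height_eq_orderHeight ⟨M.map π, hM'⟩
  rw [← hh] at hdim
  have hht' : ((Nat.card ι : ℕ∞) : WithBot ℕ∞) ≤ ((M.map π).height + E.encard : ℕ∞) :=
    WithBot.coe_le_coe.2 hht
  refine hht'.trans ?_
  rw [WithBot.coe_add]
  exact add_le_add hdim (WithBot.coe_le_coe.2 hEN)

theorem trdeg_adjoin_range_le {k L τ : Type} [Field k] [Field L] [Algebra k L] (t : τ → L) :
    Algebra.trdeg k (IntermediateField.adjoin k (Set.range t)) ≤ Cardinal.mk τ := by
  let E := IntermediateField.adjoin k (Set.range t)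
  let t' : τ → E := fun i => ⟨t i, IntermediateField.subset_adjoin k _ ⟨i, rfl⟩⟩
  have hmem : ∀ a ∈ Algebra.adjoin k (Set.range t), ∃ b ∈ Algebra.adjoin k (Set.range t'),
      (b : L) = a := by
    intro a ha
    have hmap : (Algebra.adjoin k (Set.range t')).map E.val = Algebra.adjoin k (Set.range t) := by
      rw [AlgHom.map_adjoin, ← Set.range_comp]
      rfl
    rw [← hmap] at ha
    exact ha
  have halg : Algebra.IsAlgebraic (Algebra.adjoin k (Set.range t')) E := by
    refine ⟨fun x => ?_⟩
    obtain ⟨a, ha, b, hb, hab⟩ := IntermediateField.mem_adjoin_iff_div.1 x.2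
    obtain ⟨a', ha', rfl⟩ := hmem a ha
    obtain ⟨b', hb', rfl⟩ := hmem b hb
    have hx : x = a' * b'⁻¹ := by
      rw [← div_eq_mul_inv]
      exact Subtype.ext hab
    rw [hx]
    exact (isAlgebraic_algebraMap (⟨a', ha'⟩ : Algebra.adjoin k (Set.range t'))).mul
      (isAlgebraic_algebraMap (⟨b', hb'⟩ : Algebra.adjoin k (Set.range t'))).inv
  exact (Algebra.IsAlgebraic.trdeg_le_cardinalMk k (Set.range t')).trans Cardinal.mk_range_le

theorem not_algebraicIndependent_of_mem_adjoin {k L τ κ : Type} [Field k] [Field L] [Algebra k L]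
    [Fintype τ] [Fintype κ] (hcard : Fintype.card τ < Fintype.card κ) (t : τ → L) {u : κ → L}
    (hu : ∀ i, u i ∈ IntermediateField.adjoin k (Set.range t)) : ¬ AlgebraicIndependent k u := by
  intro hind
  have h1 : AlgebraicIndependent k
      (fun i => (⟨u i, hu i⟩ : IntermediateField.adjoin k (Set.range t))) :=
    AlgebraicIndependent.of_comp (IntermediateField.adjoin k (Set.range t)).val hind
  have h2 := h1.cardinalMk_le_trdeg.trans (trdeg_adjoin_range_le t)
  rw [Cardinal.mk_fintype, Cardinal.mk_fintype] at h2
  exact absurd (Nat.cast_le.1 h2) (not_le.2 hcard)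

/-- Algebraic dependence can be tested after all homomorphisms to fields. -/
theorem exists_aeval_eq_zero_of_forall_field {k A κ : Type} [Field k] [CommRing A] [Algebra k A]
    (u : κ → A) (H : ∀ (L : Type) [Field L] [Algebra k L] (π : A →ₐ[k] L),
      ¬ AlgebraicIndependent k (fun i => π (u i))) :
    ∃ R : MvPolynomial κ k, R ≠ 0 ∧ MvPolynomial.aeval u R = 0 := by
  by_contra! hcon
  let S : Submonoid A :=
    (nonZeroDivisors (MvPolynomial κ k)).map (MvPolynomial.aeval u : MvPolynomial κ k →ₐ[k] A)
  have hdisj : Disjoint ((⊥ : Ideal A) : Set A) (S : Set A) := by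
    rw [Set.disjoint_left]
    rintro _ h0 ⟨R, hR, rfl⟩
    exact hcon R (nonZeroDivisors.ne_zero hR) h0
  obtain ⟨p, hp, -, hpS⟩ := Ideal.exists_le_prime_disjoint _ S hdisj
  let π : A →ₐ[k] FractionRing (A ⧸ p) :=
    (IsScalarTower.toAlgHom k (A ⧸ p) (FractionRing (A ⧸ p))).comp (Ideal.Quotient.mkₐ k p)
  refine H _ π (algebraicIndependent_iff.2 fun R hR => ?_)
  by_contra hR0
  rw [← MvPolynomial.comp_aeval_apply u π R] at hR
  have h1 : Ideal.Quotient.mk p (MvPolynomial.aeval u R) = 0 :=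
    IsFractionRing.injective (A ⧸ p) (FractionRing (A ⧸ p)) (by rw [map_zero]; exact hR)
  rw [Ideal.Quotient.eq_zero_iff_mem] at h1
  exact Set.disjoint_left.1 hpS h1 ⟨R, mem_nonZeroDivisors_of_ne_zero hR0, rfl⟩

theorem eval₂Hom_comp_sumAlgEquiv {k σ₁ σ₂ : Type} [Field k] (a : σ₁ → k) (b : σ₂ → k) :
    (MvPolynomial.eval₂Hom (MvPolynomial.eval b) a).comp
      (MvPolynomial.sumAlgEquiv k σ₁ σ₂ : MvPolynomial (σ₁ ⊕ σ₂) k →+* _)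
      = MvPolynomial.eval (Sum.elim a b) := by
  refine MvPolynomial.ringHom_ext (fun r => ?_) fun i => ?_
  · simp
  · rcases i with i | i <;> simp

/-- If the functions `y` and `x` on `T` jointly have transcendence degree at most `D`, then for
generic values of `y` any `D + 1 - card σ` of the functions `x` satisfy a polynomial relation. -/
theorem exists_generic_relation {k T σ ι : Type} [Field k] [Fintype σ] [Finite ι] {D m : ℕ}
    (hD : D < Fintype.card σ + m) (y : σ → T → k) (x : ι → T → k)
    (H : ∀ (L : Type) [Field L] [Algebra k L] (π : (T → k) →ₐ[k] L),
      ∃ (τ : Type) (_ : Fintype τ) (t : τ → L), Fintype.card τ ≤ D ∧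
        (∀ i, π (y i) ∈ IntermediateField.adjoin k (Set.range t)) ∧
        ∀ i, π (x i) ∈ IntermediateField.adjoin k (Set.range t)) :
    ∃ c : MvPolynomial σ k, c ≠ 0 ∧ ∀ y₀ : σ → k, MvPolynomial.eval y₀ c ≠ 0 →
      ∀ J : Fin m → ι, ∃ R : MvPolynomial (Fin m) k, R ≠ 0 ∧
        ∀ t, (∀ i, y i t = y₀ i) → MvPolynomial.eval (fun i => x (J i) t) R = 0 := by
  have key : ∀ J : Fin m → ι, ∃ c : MvPolynomial σ k, c ≠ 0 ∧
      ∀ y₀ : σ → k, MvPolynomial.eval y₀ c ≠ 0 → ∃ R : MvPolynomial (Fin m) k, R ≠ 0 ∧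
        ∀ t, (∀ i, y i t = y₀ i) → MvPolynomial.eval (fun i => x (J i) t) R = 0 := by
    intro J
    obtain ⟨R, hR, hR0⟩ := exists_aeval_eq_zero_of_forall_field (k := k)
      (Sum.elim (x ∘ J) y : Fin m ⊕ σ → T → k) (by
        intro L _ _ π
        obtain ⟨τ, _, t, hτ, hy, hx⟩ := H L π
        refine not_algebraicIndependent_of_mem_adjoin ?_ t ?_
        · rw [Fintype.card_sum, Fintype.card_fin]; omega
        · rintro (i | i)
          · exact hx (J i)
          · exact hy i)
    let R' := MvPolynomial.sumAlgEquiv k (Fin m) σ R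
    have hR' : R' ≠ 0 := by
      simpa [R'] using hR
    obtain ⟨e, he⟩ := MvPolynomial.ne_zero_iff.1 hR'
    refine ⟨MvPolynomial.coeff e R', he, fun y₀ hy₀ =>
      ⟨MvPolynomial.map (MvPolynomial.eval y₀) R', fun h0 => hy₀ ?_, fun t ht => ?_⟩⟩
    · have := congrArg (MvPolynomial.coeff e) h0
      rwa [MvPolynomial.coeff_map, MvPolynomial.coeff_zero] at this
    · have h1 : MvPolynomial.eval (Sum.elim (fun i => x (J i) t) (fun i => y i t)) R = 0 := by
        have := congrFun hR0 t
        have h2 := MvPolynomial.comp_aeval_apply (R := k) (Sum.elim (x ∘ J) y : Fin m ⊕ σ → T → k)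
          (Pi.evalAlgHom k (fun _ : T => k) t) R
        rw [hR0, map_zero, MvPolynomial.aeval_eq_eval] at h2
        rw [h2]
        congr 2
        funext i
        rcases i with i | i <;> rfl
      have hy : (fun i => y i t) = y₀ := funext ht
      rw [hy] at h1
      rw [MvPolynomial.eval_map, ← h1]
      exact DFunLike.congr_fun (eval₂Hom_comp_sumAlgEquiv (fun i => x (J i) t) y₀) R
  choose c hc hcy using key
  have := Fintype.ofFinite (Fin m → ι)
  refine ⟨∏ J, c J, Finset.prod_ne_zero_iff.2 fun J _ => hc J, fun y₀ hy₀ J => hcy J y₀ ?_⟩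
  rw [map_prod, Finset.prod_ne_zero_iff] at hy₀
  exact hy₀ J (Finset.mem_univ J)

theorem isZariskiCoord_mZariski {k ι M : Type} [Field k] [Fintype ι] [AddCommGroup M] [Module k M]
    (B : Basis ι k M) :
    @IsZariskiCoord k ι M _ (mZariski k M) (fun x i => B.repr x i) := by
  let := mZariski k M
  refine ⟨fun p => ?_, fun U hU => ?_⟩
  · refine TopologicalSpace.isOpen_generateFrom_of_mem ⟨MvPolynomial.rename B.coord p, ?_⟩
    ext x
    simp only [Set.mem_ofPred_eq, mEval, MvPolynomial.eval_rename]
    rfl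
  · induction hU with
    | basic U hU =>
      obtain ⟨p, rfl⟩ := hU
      let q : MvPolynomial ι k := MvPolynomial.aeval
        (fun l : Dual k M => ∑ i, MvPolynomial.C (l (B i)) * MvPolynomial.X i) p
      have hq : ∀ x : M, MvPolynomial.eval (fun i => B.repr x i) q = mEval k x p := by
        intro x
        have := MvPolynomial.comp_aeval_apply
          (fun l : Dual k M => ∑ i, MvPolynomial.C (l (B i)) * MvPolynomial.X i)
          (MvPolynomial.aeval (R := k) (fun i => B.repr x i)) p
        rw [MvPolynomial.aeval_eq_eval] at this
        refine this.trans ?_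
        rw [MvPolynomial.aeval_eq_eval]
        unfold mEval
        congr 2
        funext l
        conv_rhs => rw [← B.sum_repr x, map_sum]
        simp [mul_comm]
      exact fun x hx => ⟨q, by rwa [hq], fun y hy => by rwa [hq] at hy⟩
    | univ => exact fun x _ => ⟨1, by simp, fun y _ => trivial⟩
    | inter U W _ _ ihU ihW =>
      rintro x ⟨hxU, hxW⟩
      obtain ⟨p, hp, hpU⟩ := ihU x hxU
      obtain ⟨q, hq, hqW⟩ := ihW x hxW
      refine ⟨p * q, by rw [map_mul]; exact mul_ne_zero hp hq, fun y hy => ?_⟩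
      rw [map_mul] at hy
      exact ⟨hpU y (left_ne_zero_of_mul hy), hqW y (right_ne_zero_of_mul hy)⟩
    | sUnion S _ ih =>
      rintro x ⟨U, hU, hxU⟩
      obtain ⟨p, hp, hpU⟩ := ih U hU x hxU
      exact ⟨p, hp, fun y hy => ⟨U, hU, hpU y hy⟩⟩

theorem Matrix.exists_isUnit_submatrix {L κ N : Type} [Field L] [Fintype κ] [Fintype N]
    [DecidableEq N] {z : Matrix κ N L} {μ : Matrix N κ L} (h : μ * z = 1) :
    ∃ Λ : N → κ, Function.Injective Λ ∧ IsUnit (z.submatrix Λ id) := by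
  obtain ⟨κ', a, ha, hspan, hli⟩ := exists_linearIndependent' L z.row
  have htop : ⊤ ≤ span L (Set.range z.row) := by
    intro v _
    have hv : v = Matrix.vecMul (Matrix.vecMul v μ) z := by
      rw [Matrix.vecMul_vecMul, h, Matrix.vecMul_one]
    rw [hv, Matrix.vecMul_eq_sum]
    exact Submodule.sum_mem _ fun i _ => Submodule.smul_mem _ _ (subset_span ⟨i, rfl⟩)
  let b : Basis κ' L (N → L) := Basis.mk hli (hspan ▸ htop)
  let e : N ≃ κ' := (Pi.basisFun L N).indexEquiv b
  refine ⟨a ∘ e, ha.comp e.injective, ?_⟩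
  rw [← Matrix.linearIndependent_rows_iff_isUnit]
  exact hli.comp e e.injective

section

variable {k L : Type} [Field k] [Field L] [Algebra k L] (E : IntermediateField k L)

theorem IntermediateField.matrix_mul_mem {l m n : Type} [Fintype m] {A : Matrix l m L}
    {B : Matrix m n L} (hA : ∀ i j, A i j ∈ E) (hB : ∀ i j, B i j ∈ E) (i : l) (j : n) :
    (A * B) i j ∈ E := by
  rw [Matrix.mul_apply]
  exact sum_mem fun c _ => mul_mem (hA i c) (hB c j)

theorem IntermediateField.matrix_inv_mem {n : Type} [Fintype n] [DecidableEq n] {A : Matrix n n L}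
    (hA : ∀ i j, A i j ∈ E) (i j : n) : A⁻¹ i j ∈ E := by
  let A' : Matrix n n E := Matrix.of fun i j => ⟨A i j, hA i j⟩
  have hmap : A = E.val.toRingHom.mapMatrix A' := rfl
  rw [Matrix.inv_def, Matrix.smul_apply, smul_eq_mul, Ring.inverse_eq_inv']
  refine mul_mem (inv_mem ?_) ?_
  · rw [hmap, ← RingHom.map_det]
    exact A'.det.2
  · rw [hmap, ← RingHom.map_adjugate]
    exact (A'.adjugate i j).2

end

theorem sum_range_add_sum_not_range {κ N M : Type} [Fintype κ] [Fintype N] [AddCommMonoid M]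
    {Λ : N → κ} (hΛ : Function.Injective Λ) [Fintype {l // l ∉ Set.range Λ}] (f : κ → M) :
    ∑ e, f (Λ e) + ∑ l : {l // l ∉ Set.range Λ}, f l = ∑ l, f l := by
  have : ∑ e, f (Λ e) + ∑ l : {l // l ∉ Set.range Λ}, f l =
      ∑ x : N ⊕ {l // l ∉ Set.range Λ}, f (Sum.elim Λ Subtype.val x) := by
    rw [Fintype.sum_sum_type]; rfl
  rw [this]
  refine Fintype.sum_bijective (Sum.elim Λ Subtype.val) ⟨?_, fun l => ?_⟩ _ _ fun _ => rfl
  · exact hΛ.sumElim Subtype.val_injective fun e l h => l.2 ⟨e, h⟩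
  · by_cases hl : l ∈ Set.range Λ
    · obtain ⟨e, rfl⟩ := hl
      exact ⟨Sum.inl e, rfl⟩
    · exact ⟨Sum.inr ⟨l, hl⟩, rfl⟩

open scoped Classical in
theorem exists_params_of_mul {k L : Type} [Field k] [Field L] [Algebra k L] {q : ℕ} {N : Type}
    [Fintype N] [DecidableEq N] {z : Matrix (Fin q) N L} {m : N → ℕ}
    (hz : ∀ (l : Fin q) (b : N), ¬ (l : ℕ) < m b → z l b = 0) {μ : Matrix N (Fin q) L} (hμ : μ * z = 1)
    (h : Matrix (Fin q) (Fin q) L) :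
    ∃ Λ : N → Fin q, Function.Injective Λ ∧
      ∃ t : {p : Fin q × N // (p.1 : ℕ) < m p.2} ⊕ (Fin q × {l // l ∉ Set.range Λ}) → L,
        ∀ E : IntermediateField k L, (∀ i b, (h * z) i b ∈ E) → (∀ i, t i ∈ E) →
          ∀ i l, h i l ∈ E := by
  obtain ⟨Λ, hΛ, hunit⟩ := Matrix.exists_isUnit_submatrix hμ
  refine ⟨Λ, hΛ, Sum.elim (fun p => z p.1.1 p.1.2) (fun p => h p.1 p.2), fun E hE ht => ?_⟩
  have hzE : ∀ l b, z l b ∈ E := by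
    intro l b
    by_cases hlb : (l : ℕ) < m b
    · exact ht (Sum.inl ⟨(l, b), hlb⟩)
    · rw [hz l b hlb]; exact zero_mem _
  have hmul : ∀ i b, (h.submatrix id Λ * z.submatrix Λ id) i b ∈ E := by
    intro i b
    have h1 := sum_range_add_sum_not_range hΛ fun l => h i l * z l b
    have h2 : (h.submatrix id Λ * z.submatrix Λ id) i b =
        (h * z) i b - ∑ l : {l // l ∉ Set.range Λ}, h i l * z l b := by
      rw [Matrix.mul_apply, Matrix.mul_apply, ← h1]
      simp
    rw [h2]
    exact sub_mem (hE i b) (sum_mem fun l _ => mul_mem (ht (Sum.inr (i, l))) (hzE _ _))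
  have hΛE : ∀ i e, h.submatrix id Λ i e ∈ E := by
    have : h.submatrix id Λ = (h.submatrix id Λ * z.submatrix Λ id) * (z.submatrix Λ id)⁻¹ := by
      rw [Matrix.mul_assoc, Matrix.mul_nonsing_inv _ ((Matrix.isUnit_iff_isUnit_det _).1 hunit),
        Matrix.mul_one]
    rw [this]
    exact E.matrix_mul_mem hmul (E.matrix_inv_mem fun i j => hzE _ _)
  intro i l
  by_cases hl : l ∈ Set.range Λ
  · obtain ⟨e, rfl⟩ := hl
    exact hΛE i e
  · exact ht (Sum.inr (i, ⟨l, hl⟩))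

open scoped Classical in
theorem exists_params_flag {k L : Type} [Field k] [Field L] [Algebra k L] {r d : ℕ}
    {R : Type} [Fintype R] [DecidableEq R]
    (K : Fin d → Fin r) {B : R → Fin r} {y : Matrix R (Fin r) L}
    (hB : Function.Injective B) (hyB : y.submatrix id B = 1)
    {g : Matrix (Fin r) (Fin r) L} {X : Matrix {b // b ∉ Set.range K} (Fin r) L}
    (hX : ∀ (b : {b // b ∉ Set.range K}) (a : Fin r), a < (b : Fin r) → X b a = 0)
    (hyg : y * g = (y * g).submatrix id Subtype.val * X) :
    ∃ t : (Fin r × {b // b ∉ Set.range K}) ⊕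
        {p : {b // b ∉ Set.range K} × Fin d // (p.1 : Fin r) < K p.2} ⊕
        ({c // c ∉ Set.range B} × Fin d) → L,
      ∀ E : IntermediateField k L, (∀ i c, y i c ∈ E) → (∀ i, t i ∈ E) → ∀ i a, g i a ∈ E := by
  let v : Fin d → Fin r → L := fun t i => g i (K t) - ∑ b : {b // b ∉ Set.range K}, g i (b : Fin r) * X b (K t)
  refine ⟨Sum.elim (fun p => g p.1 p.2) (Sum.elim (fun p => X p.1.1 (K p.1.2))
    (fun p => v p.2 p.1)), fun E hy ht => ?_⟩
  have hgN : ∀ i (b : {b // b ∉ Set.range K}), g i b ∈ E := fun i b => ht (Sum.inl (i, b))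
  have hv0 : ∀ t e, ∑ c, y e c * v t c = 0 := by
    intro t e
    have h1 : ∑ c, y e c * g c (K t) =
        ∑ b : {b // b ∉ Set.range K}, (∑ c, y e c * g c b) * X b (K t) :=
      (congrFun (congrFun hyg e) (K t):)
    simp only [Finset.sum_mul] at h1
    simp only [v, mul_sub, Finset.sum_sub_distrib, Finset.mul_sum]
    rw [h1, Finset.sum_comm, sub_eq_zero]
    exact Finset.sum_congr rfl fun _ _ => Finset.sum_congr rfl fun _ _ => by ring
  have hvE : ∀ t i, v t i ∈ E := by
    intro t i
    by_cases hi : i ∈ Set.range B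
    · obtain ⟨e, rfl⟩ := hi
      have h1 := sum_range_add_sum_not_range hB fun c => y e c * v t c
      have h2 : ∑ e', y e (B e') * v t (B e') = v t (B e) := by
        have : ∀ e', y e (B e') = (1 : Matrix R R L) e e' := fun e' => by
          rw [← hyB]; rfl
        simp [this, Matrix.one_apply]
      rw [h2, hv0, add_eq_zero_iff_eq_neg] at h1
      rw [h1]
      exact neg_mem (sum_mem fun l _ => mul_mem (hy _ _) (ht (Sum.inr (Sum.inr (l, t)))))
    · exact ht (Sum.inr (Sum.inr (⟨i, hi⟩, t)))
  have hXE : ∀ b t, X b (K t) ∈ E := by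
    intro b t
    rcases lt_trichotomy (b : Fin r) (K t) with h | h | h
    · exact ht (Sum.inr (Sum.inl ⟨(b, t), h⟩))
    · exact absurd ⟨t, h.symm⟩ b.2
    · rw [hX b _ h]; exact zero_mem _
  intro i a
  by_cases ha : a ∈ Set.range K
  · obtain ⟨t, rfl⟩ := ha
    have : g i (K t) = v t i + ∑ b : {b // b ∉ Set.range K}, g i (b : Fin r) * X b (K t) := by
      simp [v]
    rw [this]
    exact add_mem (hvE t i) (sum_mem fun b _ => mul_mem (hgN i b) (hXE b t))
  · exact hgN i ⟨a, ha⟩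

theorem card_not_range {κ N : Type} [Fintype κ] [Fintype N] {Λ : N → κ}
    (hΛ : Function.Injective Λ) [Fintype {l // l ∉ Set.range Λ}] :
    Fintype.card {l // l ∉ Set.range Λ} = Fintype.card κ - Fintype.card N := by
  have := sum_range_add_sum_not_range hΛ fun _ => 1
  simp only [Finset.sum_const, Finset.card_univ, smul_eq_mul, mul_one] at this
  omega

theorem exists_factorization {L : Type} [Field L] {q r d : ℕ} {K : Fin d → Fin r}
    [Fintype {b // b ∉ Set.range K}] [DecidableEq {b // b ∉ Set.range K}]
    {Φ : Matrix (Fin q) (Fin r) L} {g g' : Matrix (Fin r) (Fin r) L} (hg : g * g' = 1)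
    {X : Matrix {b // b ∉ Set.range K} (Fin r) L}
    (hX : Φ * g = (Φ * g).submatrix id (Subtype.val : {b // b ∉ Set.range K} → Fin r) * X)
    {μ : Matrix {b // b ∉ Set.range K} (Fin q) L}
    (hμ : μ * (Φ * g).submatrix id (Subtype.val : {b // b ∉ Set.range K} → Fin r) = 1) :
    ∃ (B : {b // b ∉ Set.range K} → Fin r) (P : Matrix (Fin q) {b // b ∉ Set.range K} L)
      (P' : Matrix {b // b ∉ Set.range K} (Fin q) L) (y : Matrix {b // b ∉ Set.range K} (Fin r) L),
      Function.Injective B ∧ Φ = P * y ∧ P' * Φ = y ∧ y.submatrix id B = 1 := by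
  set W := (Φ * g).submatrix id (Subtype.val : {b // b ∉ Set.range K} → Fin r) with hW
  have hΦ : Φ = W * (X * g') := by
    rw [← Matrix.mul_assoc, ← hX, Matrix.mul_assoc, hg, Matrix.mul_one]
  have hY : μ * Φ = X * g' := by
    conv_lhs => rw [hΦ]
    rw [← Matrix.mul_assoc, hμ, Matrix.one_mul]
  have hY1 : (X * g') * g.submatrix id (Subtype.val : {b // b ∉ Set.range K} → Fin r) = 1 := by
    rw [← hY, Matrix.mul_assoc, ← hμ]
    rfl
  have hY2 : (g.submatrix id (Subtype.val : {b // b ∉ Set.range K} → Fin r)).transpose *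
      (X * g').transpose = 1 := by
    rw [← Matrix.transpose_mul, hY1, Matrix.transpose_one]
  obtain ⟨B, hB, hunit⟩ := Matrix.exists_isUnit_submatrix hY2
  rw [← Matrix.transpose_submatrix, Matrix.isUnit_transpose] at hunit
  have hdet := (Matrix.isUnit_iff_isUnit_det _).1 hunit
  refine ⟨B, W * (X * g').submatrix id B, ((X * g').submatrix id B)⁻¹ * μ,
    ((X * g').submatrix id B)⁻¹ * (X * g'), hB, ?_, ?_, ?_⟩
  · rw [Matrix.mul_assoc, Matrix.mul_nonsing_inv_cancel_left _ _ hdet, ← hΦ]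
  · rw [Matrix.mul_assoc, hY]
  · exact Matrix.nonsing_inv_mul _ hdet

open scoped Classical in
/-- The number of parameters needed to describe a linear map together with flags with respect to
which it satisfies the rank conditions. -/
def paramCount {s r d : ℕ} (q : ℕ) (K : Fin s → Fin d → Fin r)
    (m : ∀ j, {b // b ∉ Set.range (K j)} → ℕ) : ℕ :=
  q * (r - d) + (r - d) * d + ∑ j, (r * (r - d) +
    (Fintype.card {p : {b // b ∉ Set.range (K j)} × Fin d // (p.1 : Fin r) < K j p.2} + d * d) +
    (Fintype.card {p : Fin q × {b // b ∉ Set.range (K j)} // (p.1 : ℕ) < m j p.2} +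
      q * (q - (r - d))))

open scoped Classical in
theorem exists_params {k L : Type} [Field k] [Field L] [Algebra k L] {s q r d : ℕ} (hs : 0 < s)
    (hdr : d ≤ r) {K : Fin s → Fin d → Fin r} (hK : ∀ j, Function.Injective (K j))
    {m : ∀ j, {b // b ∉ Set.range (K j)} → ℕ}
    {Φ : Matrix (Fin q) (Fin r) L} {g g' : Fin s → Matrix (Fin r) (Fin r) L}
    {h : Fin s → Matrix (Fin q) (Fin q) L} (hg : ∀ j, g j * g' j = 1)
    {X : ∀ j, Matrix {b // b ∉ Set.range (K j)} (Fin r) L}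
    (hX : ∀ j, Φ * g j =
      (Φ * g j).submatrix id (Subtype.val : {b // b ∉ Set.range (K j)} → Fin r) * X j)
    (hX0 : ∀ j (b : {b // b ∉ Set.range (K j)}) (a : Fin r), a < (b : Fin r) → X j b a = 0)
    {μ : ∀ j, Matrix {b // b ∉ Set.range (K j)} (Fin q) L}
    (hμ : ∀ j, μ j *
      (Φ * g j).submatrix id (Subtype.val : {b // b ∉ Set.range (K j)} → Fin r) = 1)
    {z : ∀ j, Matrix (Fin q) {b // b ∉ Set.range (K j)} L}
    (hz : ∀ j, (Φ * g j).submatrix id (Subtype.val : {b // b ∉ Set.range (K j)} → Fin r) =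
      h j * z j)
    (hz0 : ∀ j (l : Fin q) (b : {b // b ∉ Set.range (K j)}), ¬ (l : ℕ) < m j b → z j l b = 0) :
    ∃ (τ : Type) (_ : Fintype τ) (t : τ → L), Fintype.card τ ≤ paramCount q K m ∧
      (∀ i a, Φ i a ∈ IntermediateField.adjoin k (Set.range t)) ∧
      (∀ j i a, g j i a ∈ IntermediateField.adjoin k (Set.range t)) ∧
      ∀ j i a, h j i a ∈ IntermediateField.adjoin k (Set.range t) := by
  have hcN : ∀ j, Fintype.card {b // b ∉ Set.range (K j)} = r - d := fun j => by
    rw [card_not_range (hK j), Fintype.card_fin, Fintype.card_fin]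
  obtain ⟨B, P, P', y, hB, hP, hP', hyB⟩ :=
    exists_factorization (hg ⟨0, hs⟩) (hX ⟨0, hs⟩) (hμ ⟨0, hs⟩)
  have hyg : ∀ j, y * g j =
      (y * g j).submatrix id (Subtype.val : {b // b ∉ Set.range (K j)} → Fin r) * X j := by
    intro j
    conv_lhs => rw [← hP', Matrix.mul_assoc, hX j, ← Matrix.mul_assoc]
    rw [← hP', Matrix.mul_assoc P' Φ]
    rfl
  choose t₁ ht₁ using fun j => exists_params_flag (k := k) (K j) hB hyB (hX0 j) (hyg j)
  have hμz : ∀ j, μ j * h j * z j = 1 := fun j => by rw [Matrix.mul_assoc, ← hz j, hμ j]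
  choose Λ hΛ t₂ ht₂ using fun j => exists_params_of_mul (k := k) (hz0 j) (hμz j) (h j)
  have hcB : Fintype.card {c // c ∉ Set.range B} = d := by
    rw [card_not_range hB, hcN, Fintype.card_fin]; omega
  have hcΛ : ∀ j, Fintype.card {l // l ∉ Set.range (Λ j)} = q - (r - d) := fun j => by
    rw [card_not_range (hΛ j), hcN, Fintype.card_fin]
  let t₀ : (Fin q × {b // b ∉ Set.range (K ⟨0, hs⟩)}) ⊕
      ({b // b ∉ Set.range (K ⟨0, hs⟩)} × {c // c ∉ Set.range B}) → L :=
    Sum.elim (fun p => P p.1 p.2) (fun p => y p.1 p.2)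
  let t := Sum.elim t₀ (fun p : Σ j, ((Fin r × {b // b ∉ Set.range (K j)}) ⊕
      {p : {b // b ∉ Set.range (K j)} × Fin d // (p.1 : Fin r) < K j p.2} ⊕
        ({c // c ∉ Set.range B} × Fin d)) ⊕
      ({p : Fin q × {b // b ∉ Set.range (K j)} // (p.1 : ℕ) < m j p.2} ⊕
        (Fin q × {l // l ∉ Set.range (Λ j)})) => Sum.elim (t₁ p.1) (t₂ p.1) p.2)
  refine ⟨_, inferInstance, t, ?_, ?_⟩
  · simp only [Fintype.card_sum, Fintype.card_prod, Fintype.card_sigma, Fintype.card_fin, hcN,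
      hcB, hcΛ, paramCount]
    exact le_refl _
  · set E := IntermediateField.adjoin k (Set.range t) with hE
    have htE : ∀ i, t i ∈ E := fun i => IntermediateField.subset_adjoin k _ ⟨i, rfl⟩
    have hPE : ∀ i b, P i b ∈ E := fun i b => htE (Sum.inl (Sum.inl (i, b)))
    have hyE : ∀ b c, y b c ∈ E := by
      intro b c
      by_cases hc : c ∈ Set.range B
      · obtain ⟨e, rfl⟩ := hc
        have := congrFun (congrFun hyB b) e
        simp only [Matrix.submatrix_apply, id, Matrix.one_apply] at this
        rw [this]
        split_ifs
        exacts [one_mem _, zero_mem _]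
      · exact htE (Sum.inl (Sum.inr (b, ⟨c, hc⟩)))
    have hΦE : ∀ i a, Φ i a ∈ E := by
      rw [hP]; exact E.matrix_mul_mem hPE hyE
    have hgE : ∀ j i a, g j i a ∈ E := fun j =>
      ht₁ j E hyE fun i => htE (Sum.inr ⟨j, Sum.inl i⟩)
    refine ⟨hΦE, hgE, fun j => ht₂ j E ?_ fun i => htE (Sum.inr ⟨j, Sum.inr i⟩)⟩
    rw [← hz j]
    exact fun i b => E.matrix_mul_mem hΦE (hgE j) i b

theorem finrank_span_image_eq_card_iff {k Q : Type} [Field k] [AddCommGroup Q] [Module k Q]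
    {r : ℕ} (w : Fin r → Q) (S : Set (Fin r)) [DecidablePred (· ∈ S)] :
    (∀ u ≤ r, finrank k (span k (w '' {a | (a : ℕ) < u})) =
      (Finset.univ.filter fun b : Fin r => b ∈ S ∧ (b : ℕ) < u).card) ↔
    LinearIndependent k (fun b : S => w b) ∧ ∀ a, w a ∈ span k (w '' {b | b ≤ a ∧ b ∈ S}) := by
  have hfd : ∀ T : Set (Fin r), FiniteDimensional k (span k (w '' T)) := fun T =>
    FiniteDimensional.span_of_finite k (T.toFinite.image w)
  have hsub : ∀ T : Set (Fin r), T ⊆ S → LinearIndependent k (fun b : S => w b) →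
      finrank k (span k (w '' T)) = Nat.card T := by
    intro T hT hli
    classical
    have h1 : LinearIndependent k (fun b : T => w b) :=
      hli.comp (Set.inclusion hT) (Set.inclusion_injective hT)
    have := finrank_span_eq_card h1
    rwa [Set.range_comp' w, Subtype.range_val, ← Nat.card_eq_fintype_card] at this
  constructor
  · intro H
    have hspan : ∀ u ≤ r, span k (w '' {a | (a : ℕ) < u}) ≤
        span k (w '' {b | (b : ℕ) < u ∧ b ∈ S}) := by
      intro u
      induction u with
      | zero => intro _; simp
      | succ u ih =>
        intro hu
        have ih' := (ih (by omega)).trans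
          (span_mono (Set.image_mono (t := {b : Fin r | (b : ℕ) < u + 1 ∧ b ∈ S})
            fun b hb => ⟨Nat.lt_succ_of_lt hb.1, hb.2⟩))
        rw [span_le]
        rintro _ ⟨a, ha, rfl⟩
        rcases Nat.lt_succ_iff_lt_or_eq.1 ha with h | h
        · exact ih' (subset_span ⟨a, h, rfl⟩)
        · by_cases haS : a ∈ S
          · exact subset_span ⟨a, ⟨ha, haS⟩, rfl⟩
          · apply ih'
            have hle : span k (w '' {a | (a : ℕ) < u}) ≤ span k (w '' {a | (a : ℕ) < u + 1}) :=
              span_mono (Set.image_mono fun b hb => Nat.lt_succ_of_lt hb)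
            have hcard : (Finset.univ.filter fun b : Fin r => b ∈ S ∧ (b : ℕ) < u) =
                (Finset.univ.filter fun b : Fin r => b ∈ S ∧ (b : ℕ) < u + 1) := by
              ext b
              simp only [Finset.mem_filter, Finset.mem_univ, true_and]
              refine and_congr_right fun hb => ⟨Nat.lt_succ_of_lt, fun hb' => ?_⟩
              refine (Nat.lt_succ_iff_lt_or_eq.1 hb').resolve_right fun hb'' => haS ?_
              rwa [Fin.ext (h.trans hb''.symm)]
            have := hfd {a | (a : ℕ) < u + 1}
            rw [Submodule.eq_of_le_of_finrank_eq hle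
              ((H u (by omega)).trans (hcard ▸ (H (u + 1) hu).symm))]
            exact subset_span ⟨a, ha, rfl⟩
    refine ⟨?_, fun a => ?_⟩
    · rw [linearIndependent_iff_card_eq_finrank_span, Set.finrank]
      have h1 := H r le_rfl
      have h2 : span k (w '' {a | (a : ℕ) < r}) = span k (w '' S) := by
        refine le_antisymm ((hspan r le_rfl).trans (span_mono (Set.image_mono fun b hb => hb.2)))
          (span_mono (Set.image_mono fun b _ => b.2))
      rw [Set.range_comp' w, Subtype.range_val, ← h2, h1, Fintype.card_subtype]
      congr 1
      ext b
      simp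
    · have := hspan (a + 1) a.2 (subset_span ⟨a, Nat.lt_succ_self _, rfl⟩)
      refine span_mono (Set.image_mono ?_) this
      exact fun b hb => ⟨Nat.lt_succ_iff.1 hb.1, hb.2⟩
  · rintro ⟨hli, hmem⟩ u _
    have h2 : span k (w '' {a | (a : ℕ) < u}) = span k (w '' {b | b ∈ S ∧ (b : ℕ) < u}) := by
      refine le_antisymm (span_le.2 ?_) (span_mono (Set.image_mono fun b hb => hb.2))
      rintro _ ⟨a, ha, rfl⟩
      refine span_mono (Set.image_mono ?_) (hmem a)
      exact fun b hb => ⟨hb.2, lt_of_le_of_lt hb.1 ha⟩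
    rw [h2, hsub _ (fun b hb => hb.1) hli, Nat.card_eq_fintype_card, Fintype.card_subtype]
    rfl


section

variable {k V Q : Type} [Field k] [AddCommGroup V] [Module k V] [AddCommGroup Q] [Module k Q]

theorem spanFlag_mono {r : ℕ} (e : Fin r → V) : Monotone (spanFlag k e) :=
  fun _ _ h => span_mono (Set.image_mono fun _ ha => lt_of_lt_of_le ha h)

theorem mem_homConstraint_iff {p : Submodule k V} {q : Submodule k Q} {φ : V →ₗ[k] Q} :
    φ ∈ homConstraint p q ↔ p ≤ q.comap φ := by
  simp only [homConstraint, LinearMap.mem_ker, LinearMap.ext_iff, SetLike.le_def]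
  simp [Submodule.Quotient.mk_eq_zero]

theorem card_filter_val_lt {r u : ℕ} (hu : u ≤ r) :
    (Finset.univ.filter fun a : Fin r => (a : ℕ) < u).card = u := by
  have hc : (Finset.univ.filter fun a : Fin r => (a : ℕ) < u) =
      (Finset.univ : Finset (Fin u)).map (Fin.castLEEmb hu) := by
    ext a
    simp only [Finset.mem_filter, Finset.mem_univ, true_and, Finset.mem_map]
    exact ⟨fun h => ⟨⟨a, h⟩, rfl⟩, fun ⟨b, hb⟩ => hb ▸ b.2⟩
  rw [hc, Finset.card_map, Finset.card_univ, Fintype.card_fin]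

theorem finrank_ker_inf_spanFlag_add {r : ℕ} {e : Fin r → V} (he : LinearIndependent k e)
    (φ : V →ₗ[k] Q) {u : ℕ} (hu : u ≤ r) :
    finrank k (span k ((fun a => φ (e a)) '' {a | (a : ℕ) < u})) +
      finrank k ↥(LinearMap.ker φ ⊓ spanFlag k e u) = u := by
  have hF : finrank k (spanFlag k e u) = u := by
    have h1 : LinearIndependent k (fun b : {a : Fin r // (a : ℕ) < u} => e b) :=
      he.comp _ Subtype.val_injective
    have := finrank_span_eq_card h1
    rw [Set.range_comp' e, Subtype.range_coe_subtype, Fintype.card_subtype] at this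
    rw [spanFlag, this]
    exact card_filter_val_lt hu
  have : FiniteDimensional k (spanFlag k e u) :=
    FiniteDimensional.span_of_finite k (Set.toFinite _)
  have h := LinearMap.finrank_range_add_finrank_ker (φ.domRestrict (spanFlag k e u))
  rw [hF, LinearMap.range_domRestrict, LinearMap.ker_domRestrict] at h
  have h2 : finrank k ↥(LinearMap.ker φ ⊓ spanFlag k e u) =
      finrank k ((LinearMap.ker φ).submoduleOf (spanFlag k e u)) := by
    rw [inf_comm, ← Submodule.map_comap_subtype, finrank_map_subtype_eq]
    rfl
  rw [h2]
  rw [spanFlag, map_span, Set.image_image] at h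
  exact h

theorem card_filter_range_add {r d : ℕ} {K : Fin d → Fin r} (hK : Function.Injective K)
    [DecidablePred (· ∈ {b | b ∉ Set.range K})] {u : ℕ} (hu : u ≤ r) :
    (Finset.univ.filter fun b : Fin r => b ∈ {b | b ∉ Set.range K} ∧ (b : ℕ) < u).card +
      (Finset.univ.filter fun a : Fin d => (K a : ℕ) + 1 ≤ u).card = u := by
  classical
  have h := sum_range_add_sum_not_range hK fun b => if (b : ℕ) < u then 1 else 0
  rw [← Finset.sum_subtype (Finset.univ.filter (· ∈ {b | b ∉ Set.range K})) (by simp)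
    (f := fun b : Fin r => if (b : ℕ) < u then 1 else 0), ← Finset.card_filter,
    ← Finset.card_filter, ← Finset.card_filter, Finset.filter_filter, card_filter_val_lt hu] at h
  rw [add_comm]
  exact h

theorem cellMem_ker_iff {r d : ℕ} {e : Fin r → V} (he : LinearIndependent k e)
    (hV : finrank k V = r) [FiniteDimensional k V] {K : Fin d → Fin r} (hK : Function.Injective K)
    (φ : V →ₗ[k] Q) :
    cellMem K (spanFlag k e) (LinearMap.ker φ) ↔
      LinearIndependent k (fun b : {b // b ∉ Set.range K} => φ (e b)) ∧
      ∀ a, φ (e a) ∈ span k ((fun a => φ (e a)) '' {b | b ≤ a ∧ b ∉ Set.range K}) := by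
  classical
  have key := finrank_span_image_eq_card_iff (k := k) (fun a => φ (e a)) {b | b ∉ Set.range K}
  refine Iff.trans ?_ key
  have hiff : ∀ u ≤ r, finrank k ↥(LinearMap.ker φ ⊓ spanFlag k e u) =
      (Finset.univ.filter fun a : Fin d => (K a : ℕ) + 1 ≤ u).card ↔
      finrank k (span k ((fun a => φ (e a)) '' {a | (a : ℕ) < u})) =
      (Finset.univ.filter fun b : Fin r => b ∈ {b | b ∉ Set.range K} ∧ (b : ℕ) < u).card := by
    intro u hu
    have h1 := finrank_ker_inf_spanFlag_add he φ hu
    have h2 := card_filter_range_add hK hu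
    omega
  have htop : spanFlag k e r = ⊤ := by
    have := he.span_eq_top_of_card_eq_finrank' (by simp [hV])
    rw [spanFlag, ← this]
    congr 1
    ext; simp
  rw [cellMem, forall₂_congr hiff, and_iff_right_iff_imp]
  intro H
  have := (hiff r le_rfl).2 (H r le_rfl)
  rw [htop, inf_top_eq] at this
  rw [this]
  exact (congrArg Finset.card (Finset.filter_true_of_mem fun a _ => (K a).2)).trans (by simp)

theorem val_sub_mono {r n : ℕ} {i : Fin r → Fin n} (hi : StrictMono i) :
    Monotone fun a : Fin r => (i a : ℕ) - a := by
  have h : ∀ m : ℕ, ∀ a b : Fin r, (b : ℕ) = a + m → (i a : ℕ) + m ≤ i b := by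
    intro m
    induction m with
    | zero => exact fun a b h => le_of_eq (by rw [Fin.ext (show (b : ℕ) = a from h)]; rfl)
    | succ m ih =>
      intro a b hab
      have hlt : (⟨a + m, by omega⟩ : Fin r) < b := by rw [Fin.lt_def]; simp only; omega
      have h1 := ih a ⟨a + m, by omega⟩ rfl
      have h2 : (i ⟨a + m, by omega⟩ : ℕ) < i b := hi hlt
      omega
  intro a b hab
  have h1 := h (b - a) a b (by have : (a : ℕ) ≤ b := hab; omega)
  have h2 : (a : ℕ) ≤ b := hab
  simp only
  omega

/-- Coordinate description of the locus of linear maps satisfying the flag conditions. -/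
theorem mem_locus_iff {n r d s q : ℕ} (hs : 0 < s) [FiniteDimensional k V] (hV : finrank k V = r)
    {I : Fin s → Fin r → Fin n} (hI : ∀ j, StrictMono (I j))
    {K : Fin s → Fin d → Fin r} (hK : ∀ j, Function.Injective (K j))
    {e : Fin s → Fin r → V} (he : ∀ j, LinearIndependent k (e j))
    (f : Fin s → Fin q → Q) (φ : V →ₗ[k] Q) :
    (φ ∈ homSpace I (fun j => spanFlag k (e j)) (fun j => spanFlag k (f j)) ∧
        finrank k (LinearMap.ker φ) = d ∧
        ∀ j, cellMem (K j) (spanFlag k (e j)) (LinearMap.ker φ)) ↔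
      ∀ j, LinearIndependent k (fun b : {b // b ∉ Set.range (K j)} => φ (e j b)) ∧
        (∀ a, φ (e j a) ∈
          span k ((fun a => φ (e j a)) '' {b | b ≤ a ∧ b ∉ Set.range (K j)})) ∧
        ∀ b : {b // b ∉ Set.range (K j)},
          φ (e j b) ∈ span k (f j '' {l | (l : ℕ) < (I j b : ℕ) - (b : Fin r)}) := by
  have h1 : (φ ∈ homSpace I (fun j => spanFlag k (e j)) (fun j => spanFlag k (f j)) ∧
        finrank k (LinearMap.ker φ) = d ∧
        ∀ j, cellMem (K j) (spanFlag k (e j)) (LinearMap.ker φ)) ↔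
      ∀ j, cellMem (K j) (spanFlag k (e j)) (LinearMap.ker φ) ∧ ∀ a : Fin r,
        spanFlag k (e j) (a + 1) ≤ (spanFlag k (f j) ((I j a : ℕ) - a)).comap φ := by
    simp only [homSpace, mem_iInf, mem_homConstraint_iff, forall_and]
    exact ⟨fun h => ⟨h.2.2, h.1⟩, fun h => ⟨h.2, (h.1 ⟨0, hs⟩).1, h.1⟩⟩
  rw [h1]
  refine forall_congr' fun j => ?_
  rw [cellMem_ker_iff (he j) hV (hK j), and_assoc]
  refine and_congr_right fun _ => and_congr_right fun hmem => ⟨fun H b => ?_, fun H a => ?_⟩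
  · exact H b (subset_span ⟨b, Nat.lt_succ_self _, rfl⟩)
  · rw [spanFlag, span_le]
    rintro _ ⟨a', ha', rfl⟩
    have hle : span k ((fun a => φ (e j a)) '' {b | b ≤ a' ∧ b ∉ Set.range (K j)}) ≤
        spanFlag k (f j) ((I j a : ℕ) - a) := by
      rw [span_le]
      rintro _ ⟨b, hb, rfl⟩
      have hba : b ≤ a := hb.1.trans (Nat.lt_succ_iff.1 ha')
      exact spanFlag_mono (k := k) (f j) (val_sub_mono (hI j) hba) (H ⟨b, hb.2⟩)
    exact hle (hmem a')

end

section

variable {k V Q : Type} [Field k] [AddCommGroup V] [Module k V] [AddCommGroup Q] [Module k Q]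

/-- The linear maps `φ` such that, for every `j`, the vectors `φ (e j b)` with `b` outside the range
of `K j` are independent, lie in prescribed members of the flag of `f j`, and span the image
of the flag of `e j` compatibly. -/
def flagLocus {r d s q : ℕ} (K : Fin s → Fin d → Fin r) (m : ∀ j, {b // b ∉ Set.range (K j)} → ℕ)
    (e : Fin s → Fin r → V) (f : Fin s → Fin q → Q) : Set (V →ₗ[k] Q) :=
  {φ | ∀ j, LinearIndependent k (fun b : {b // b ∉ Set.range (K j)} => φ (e j b)) ∧
    (∀ a, φ (e j a) ∈ span k ((fun a => φ (e j a)) '' {b | b ≤ a ∧ b ∉ Set.range (K j)})) ∧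
    ∀ b : {b // b ∉ Set.range (K j)}, φ (e j b) ∈ span k (f j '' {l | (l : ℕ) < m j b})}

theorem exists_coeff_of_mem_span_image {ι : Type} [Fintype ι] {v : ι → Q} {S : Set ι} {x : Q}
    (hx : x ∈ span k (v '' S)) : ∃ c : ι → k, x = ∑ i, c i • v i ∧ ∀ i ∉ S, c i = 0 := by
  classical
  obtain ⟨l, hl, rfl⟩ := (Finsupp.mem_span_image_iff_linearCombination k).1 hx
  refine ⟨l, ?_, fun i hi => ?_⟩
  · rw [Finsupp.linearCombination_apply, Finsupp.sum_fintype _ _ (by simp)]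
  · by_contra h
    exact hi (hl (Finsupp.mem_support_iff.2 h))

theorem exists_left_inverse_repr {q : ℕ} {N : Type} [Fintype N] [DecidableEq N]
    (bQ : Basis (Fin q) k Q) {w : N → Q} (hw : LinearIndependent k w) :
    ∃ μ : Matrix N (Fin q) k, μ * (Matrix.of fun i b => bQ.repr (w b) i) = 1 := by
  have hw' : LinearIndependent k fun b => bQ.equivFun (w b) :=
    hw.map' bQ.equivFun.toLinearMap bQ.equivFun.ker
  obtain ⟨g, hg⟩ := (Matrix.mulVecLin (Matrix.of fun i b => bQ.repr (w b) i)).exists_leftInverse_of_injective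
    (Matrix.ker_mulVecLin_eq_bot_iff.2 fun v hv => by
      rw [Matrix.mulVec_eq_sum] at hv
      exact funext (Fintype.linearIndependent_iff.1 hw' v (by
        rw [← hv]; ext i; simp [Basis.equivFun_apply])))
  refine ⟨LinearMap.toMatrix' g, ?_⟩
  have := congrArg LinearMap.toMatrix' hg
  rwa [LinearMap.toMatrix'_comp, LinearMap.toMatrix'_id, ← Matrix.toLin'_apply',
    LinearMap.toMatrix'_toLin'] at this

theorem exists_matrices {r d q : ℕ} (bV : Basis (Fin r) k V) (bQ : Basis (Fin q) k Q)
    {K : Fin d → Fin r} {m : {b // b ∉ Set.range K} → ℕ} [Fintype {b // b ∉ Set.range K}]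
    [DecidableEq {b // b ∉ Set.range K}]
    {e : Fin r → V} {f : Fin q → Q} (he : LinearIndependent k e) {φ : V →ₗ[k] Q}
    (h1 : LinearIndependent k (fun b : {b // b ∉ Set.range K} => φ (e b)))
    (h2 : ∀ a, φ (e a) ∈ span k ((fun a => φ (e a)) '' {b | b ≤ a ∧ b ∉ Set.range K}))
    (h3 : ∀ b : {b // b ∉ Set.range K}, φ (e b) ∈ span k (f '' {l | (l : ℕ) < m b})) :
    ∃ (g' : Matrix (Fin r) (Fin r) k) (X : Matrix {b // b ∉ Set.range K} (Fin r) k)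
      (μ : Matrix {b // b ∉ Set.range K} (Fin q) k) (z : Matrix (Fin q) {b // b ∉ Set.range K} k),
      bV.toMatrix e * g' = 1 ∧
      LinearMap.toMatrix bV bQ φ * bV.toMatrix e =
        (LinearMap.toMatrix bV bQ φ * bV.toMatrix e).submatrix id
          (Subtype.val : {b // b ∉ Set.range K} → Fin r) * X ∧
      (∀ (b : {b // b ∉ Set.range K}) (a : Fin r), a < (b : Fin r) → X b a = 0) ∧
      μ * (LinearMap.toMatrix bV bQ φ * bV.toMatrix e).submatrix id
        (Subtype.val : {b // b ∉ Set.range K} → Fin r) = 1 ∧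
      (LinearMap.toMatrix bV bQ φ * bV.toMatrix e).submatrix id
        (Subtype.val : {b // b ∉ Set.range K} → Fin r) = bQ.toMatrix f * z ∧
      ∀ (l : Fin q) (b : {b // b ∉ Set.range K}), ¬ (l : ℕ) < m b → z l b = 0 := by
  have hW : LinearMap.toMatrix bV bQ φ * bV.toMatrix e =
      Matrix.of fun i a => bQ.repr (φ (e a)) i := by
    ext i a
    rw [Matrix.of_apply, ← LinearMap.toMatrix_mulVec_repr bV bQ φ (e a)]
    rfl
  have hWs : (Matrix.of fun i a => bQ.repr (φ (e a)) i).submatrix id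
      (Subtype.val : {b // b ∉ Set.range K} → Fin r) =
      Matrix.of fun i (b : {b // b ∉ Set.range K}) => bQ.repr (φ (e b)) i := rfl
  obtain ⟨μ, hμ⟩ := exists_left_inverse_repr bQ h1
  choose X hX hX0 using fun a => exists_coeff_of_mem_span_image (h2 a)
  choose z hz hz0 using fun b => exists_coeff_of_mem_span_image (h3 b)
  have hunit : IsUnit (bV.toMatrix e) := by
    have hsp : ⊤ ≤ span k (Set.range e) := by
      have := Module.Finite.of_basis bV
      rw [he.span_eq_top_of_card_eq_finrank' (by rw [finrank_eq_card_basis bV])]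
    have := (bV.toMatrix_mul_toMatrix_flip (Basis.mk he hsp))
    rw [Basis.coe_mk] at this
    exact IsUnit.of_mul_eq_one _ this
  rw [hW, hWs]
  refine ⟨(bV.toMatrix e)⁻¹, Matrix.of fun b a => X a b, μ, Matrix.of fun l b => z b l,
    Matrix.mul_nonsing_inv _ ((Matrix.isUnit_iff_isUnit_det _).1 hunit), ?_, ?_, hμ, ?_, ?_⟩
  · ext i a
    rw [Matrix.mul_apply, Matrix.of_apply]
    conv_lhs => rw [hX a]
    rw [map_sum, Finsupp.finsetSum_apply]
    classical
    rw [← Finset.sum_subset (Finset.subset_univ (Finset.univ.filter (· ∉ Set.range K))),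
      Finset.sum_subtype _ (p := (· ∉ Set.range K)) (by simp)]
    · refine Finset.sum_congr rfl fun b _ => ?_
      simp [mul_comm]
    · intro b _ hb
      rw [hX0 a b fun h => hb (by simpa using h.2)]
      simp
  · exact fun b a hab => hX0 a b fun h => absurd hab (not_lt.2 h.1)
  · ext i b
    rw [Matrix.mul_apply, Matrix.of_apply, hz b, map_sum, Finsupp.finsetSum_apply]
    exact Finset.sum_congr rfl fun l _ => by simp [Basis.toMatrix_apply, mul_comm]
  · exact fun l b hl => hz0 b l hl

theorem matrix_map_mul_eq {T L : Type} [Field L] [Algebra k L] {l n o : Type} [Fintype n]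
    (π : (T → k) →ₐ[k] L) {A : T → Matrix l n k} {B : T → Matrix n o k} :
    (Matrix.of fun i a => π fun t => (A t * B t) i a) =
      (Matrix.of fun i a => π fun t => A t i a) * Matrix.of fun i a => π fun t => B t i a := by
  ext i a
  simp only [Matrix.of_apply, Matrix.mul_apply, ← map_mul, ← map_sum]
  congr 1
  ext t
  simp [Finset.sum_apply]

theorem matrix_map_one_eq {T L : Type} [Field L] [Algebra k L] {n : Type} [DecidableEq n]
    (π : (T → k) →ₐ[k] L) :
    (Matrix.of fun i a => π fun _ => (1 : Matrix n n k) i a) = 1 := by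
  ext i a
  simp only [Matrix.of_apply, Matrix.one_apply]
  split_ifs
  exacts [map_one π, map_zero π]

theorem exists_generic_relation_flagLocus {r d s q : ℕ} (hs : 0 < s) (hdr : d ≤ r)
    {K : Fin s → Fin d → Fin r} (hK : ∀ j, Function.Injective (K j))
    (m : ∀ j, {b // b ∉ Set.range (K j)} → ℕ) (bV : Basis (Fin r) k V) (bQ : Basis (Fin q) k Q)
    {M : ℕ} (hM : paramCount q K m < s * (r * r + q * q) + M) :
    ∃ c : MvPolynomial ((Fin s × Fin r × Fin r) ⊕ (Fin s × Fin q × Fin q)) k, c ≠ 0 ∧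
      ∀ (e : Fin s → Fin r → V) (f : Fin s → Fin q → Q), (∀ j, LinearIndependent k (e j)) →
        MvPolynomial.eval (Sum.elim (fun i => bV.repr (e i.1 i.2.2) i.2.1)
          (fun i => bQ.repr (f i.1 i.2.2) i.2.1)) c ≠ 0 →
        ∀ J : Fin M → Fin q × Fin r, ∃ R : MvPolynomial (Fin M) k, R ≠ 0 ∧
          ∀ φ ∈ flagLocus K m e f,
            MvPolynomial.eval (fun i => LinearMap.toMatrix bV bQ φ (J i).1 (J i).2) R = 0 := by
  classical
  let T := {t : (V →ₗ[k] Q) × (Fin s → Fin r → V) × (Fin s → Fin q → Q) //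
    (∀ j, LinearIndependent k (t.2.1 j)) ∧ t.1 ∈ flagLocus K m t.2.1 t.2.2}
  choose g' X μ z h1 h2 h3 h4 h5 h6 using fun (t : T) (j : Fin s) =>
    exists_matrices bV bQ (t.2.1 j) (t.2.2 j).1 (t.2.2 j).2.1 (t.2.2 j).2.2
  obtain ⟨c, hc, H⟩ := exists_generic_relation (k := k) (T := T)
    (σ := (Fin s × Fin r × Fin r) ⊕ (Fin s × Fin q × Fin q)) (ι := Fin q × Fin r)
    (D := paramCount q K m) (m := M) (by simpa [mul_add] using hM)
    (Sum.elim (fun i t => bV.toMatrix (t.1.2.1 i.1) i.2.1 i.2.2)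
      (fun i t => bQ.toMatrix (t.1.2.2 i.1) i.2.1 i.2.2))
    (fun i t => LinearMap.toMatrix bV bQ t.1.1 i.1 i.2) (by
      intro L _ _ π
      obtain ⟨τ, hτ, t, hcard, hΦ, hg, hh⟩ := exists_params (k := k) (L := L) hs hdr hK (m := m)
        (Φ := Matrix.of fun i a => π fun t => LinearMap.toMatrix bV bQ t.1.1 i a)
        (g := fun j => Matrix.of fun i a => π fun t => bV.toMatrix (t.1.2.1 j) i a)
        (g' := fun j => Matrix.of fun i a => π fun t => g' t j i a)
        (h := fun j => Matrix.of fun i a => π fun t => bQ.toMatrix (t.1.2.2 j) i a)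
        (X := fun j => Matrix.of fun i a => π fun t => X t j i a)
        (μ := fun j => Matrix.of fun i a => π fun t => μ t j i a)
        (z := fun j => Matrix.of fun i a => π fun t => z t j i a)
        (fun j => by simp only [← matrix_map_mul_eq, h1, matrix_map_one_eq])
        (fun j => by
          simp only [← matrix_map_mul_eq]
          refine Eq.trans ?_ (matrix_map_mul_eq π (A := fun t => (LinearMap.toMatrix bV bQ t.1.1 *
            bV.toMatrix (t.1.2.1 j)).submatrix id (Subtype.val : {b // b ∉ Set.range (K j)} → Fin r))
            (B := fun t => X t j))
          simp only [← h2])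
        (fun j b a hab => by
          simp only [Matrix.of_apply, h3 _ j b a hab]
          exact map_zero π)
        (fun j => by
          simp only [← matrix_map_mul_eq]
          refine (matrix_map_mul_eq π (A := fun t => μ t j) (B := fun t => (LinearMap.toMatrix bV bQ t.1.1 *
            bV.toMatrix (t.1.2.1 j)).submatrix id (Subtype.val : {b // b ∉ Set.range (K j)} → Fin r))).symm.trans ?_
          simp only [h4, matrix_map_one_eq])
        (fun j => by
          simp only [← matrix_map_mul_eq]
          simp only [← h5]
          rfl)
        (fun j l b hlb => by
          simp only [Matrix.of_apply, h6 _ j l b hlb]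
          exact map_zero π)
      refine ⟨τ, hτ, t, hcard, ?_, fun i => hΦ i.1 i.2⟩
      rintro (i | i)
      · exact hg _ _ _
      · exact hh _ _ _)
  refine ⟨c, hc, fun e f he hef J => ?_⟩
  obtain ⟨R, hR, hR'⟩ := H _ hef J
  refine ⟨R, hR, fun φ hφ => hR' ⟨(φ, e, f), he, hφ⟩ ?_⟩
  rintro (i | i)
  · rfl
  · rfl

end

section

variable {k V Q : Type} [Field k] [AddCommGroup V] [Module k V] [AddCommGroup Q] [Module k Q]

theorem exists_basis_sum_extend [FiniteDimensional k Q] {N : Type} [Fintype N] {w : N → Q}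
    (hw : LinearIndependent k w) :
    ∃ β : Basis (N ⊕ Fin (finrank k Q - Fintype.card N)) k Q, ∀ b, β (Sum.inl b) = w b := by
  classical
  have hfin : Finite (N ⊕ Basis.sumExtendIndex hw) := Module.Finite.finite_basis (Basis.sumExtend hw)
  have : Finite (Basis.sumExtendIndex hw) := Finite.of_injective _ (Sum.inr_injective (α := N))
  have := Fintype.ofFinite (Basis.sumExtendIndex hw)
  have hcard : Fintype.card (Basis.sumExtendIndex hw) = finrank k Q - Fintype.card N := by
    rw [finrank_eq_card_basis (Basis.sumExtend hw), Fintype.card_sum]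
    omega
  refine ⟨(Basis.sumExtend hw).reindex (Equiv.sumCongr (Equiv.refl N)
    (Fintype.equivFinOfCardEq hcard)), fun b => ?_⟩
  rw [Basis.reindex_apply]
  change Basis.sumExtend hw (Sum.inl b) = w b
  unfold Basis.sumExtend
  rw [Basis.reindex_apply]
  exact (Basis.extend_apply_self _ _).trans rfl

section Cramer

variable {N C : Type} [Fintype N] [DecidableEq N] (β : Basis (N ⊕ C) k Q) (w : N → Q)

/-- The square matrix of the first coordinates of a family of vectors. -/
def coordMatrix : Matrix N N k := Matrix.of fun b' b => β.repr (w b) (Sum.inl b')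

/-- The numerators in Cramer's rule for the first coordinates of a vector. -/
def cramerCoeff (x : Q) : N → k :=
  (coordMatrix β w).cramer fun b' => β.repr x (Sum.inl b')

/-- The last coordinates of the difference between a multiple of a vector and its candidate
expression given by Cramer's rule. -/
def cramerDefect (x : Q) (c : C) : k :=
  (coordMatrix β w).det * β.repr x (Sum.inr c) -
    ∑ b, cramerCoeff β w x b * β.repr (w b) (Sum.inr c)

variable {β w}

theorem linearIndependent_of_det_coordMatrix_ne_zero (hD : (coordMatrix β w).det ≠ 0) :
    LinearIndependent k w := by
  rw [Fintype.linearIndependent_iff]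
  intro c hc
  refine congrFun (Matrix.eq_zero_of_mulVec_eq_zero hD (v := c) ?_)
  ext b'
  have := congrArg (fun x => β.repr x (Sum.inl b')) hc
  simpa [Matrix.mulVec, dotProduct, coordMatrix, mul_comm] using this

theorem cramerCoeff_sum (u : N → k) :
    cramerCoeff β w (∑ b, u b • w b) = (coordMatrix β w).det • u := by
  have : (fun b' => β.repr (∑ b, u b • w b) (Sum.inl b')) = (coordMatrix β w).mulVec u := by
    ext b'
    simp [Matrix.mulVec, dotProduct, coordMatrix, mul_comm]
  rw [cramerCoeff, this, Matrix.cramer_eq_adjugate_mulVec, Matrix.mulVec_mulVec,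
    Matrix.adjugate_mul, Matrix.smul_mulVec, Matrix.one_mulVec]

theorem cramerDefect_eq_zero_iff (hD : (coordMatrix β w).det ≠ 0) {x : Q} :
    (∀ c, cramerDefect β w x c = 0) ↔ x ∈ span k (Set.range w) := by
  rw [Submodule.mem_span_range_iff_exists_fun]
  constructor
  · intro H
    refine ⟨(coordMatrix β w).det⁻¹ • cramerCoeff β w x, ?_⟩
    have h0 : (coordMatrix β w).det • x = ∑ b, cramerCoeff β w x b • w b := by
      refine β.repr.injective (Finsupp.ext ?_)
      rintro (b' | c)
      · have := congrFun (Matrix.mulVec_cramer (coordMatrix β w)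
          fun b' => β.repr x (Sum.inl b')) b'
        simp only [Matrix.mulVec, dotProduct, Pi.smul_apply, smul_eq_mul] at this
        simp only [map_smul, map_sum, Finsupp.smul_apply, Finsupp.finsetSum_apply, smul_eq_mul]
        rw [← this]
        exact Finset.sum_congr rfl fun b _ => mul_comm _ _
      · simpa [cramerDefect, sub_eq_zero] using H c
    simp only [Pi.smul_apply, smul_eq_mul, mul_smul, ← Finset.smul_sum, ← h0]
    rw [inv_smul_smul₀ hD]
  · rintro ⟨u, rfl⟩ c
    rw [cramerDefect, cramerCoeff_sum]
    simp [Finset.mul_sum, mul_assoc]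

theorem cramerCoeff_eq_zero_iff (hD : (coordMatrix β w).det ≠ 0) {x : Q} {T : Set N}
    (hx : x ∈ span k (Set.range w)) :
    (∀ b ∉ T, cramerCoeff β w x b = 0) ↔ x ∈ span k (w '' T) := by
  constructor
  · intro H
    obtain ⟨u, rfl⟩ := (Submodule.mem_span_range_iff_exists_fun k).1 hx
    rw [cramerCoeff_sum] at H
    refine Submodule.sum_mem _ fun b _ => ?_
    by_cases hb : b ∈ T
    · exact smul_mem _ _ (subset_span ⟨b, hb, rfl⟩)
    · have := H b hb
      rw [Pi.smul_apply, smul_eq_mul, mul_eq_zero, or_iff_right hD] at this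
      rw [this, zero_smul]
      exact zero_mem _
  · intro H b hb
    obtain ⟨u, rfl, hu⟩ := exists_coeff_of_mem_span_image H
    rw [cramerCoeff_sum, Pi.smul_apply, hu b hb, smul_zero]

end Cramer

section Subalgebra

variable {Y N C : Type} [Fintype N] [DecidableEq N] {S : Subalgebra k (Y → k)}

theorem Subalgebra.det_mem {n : Type} [Fintype n] [DecidableEq n] {A : Y → Matrix n n k}
    (hA : ∀ i j, (fun y => A y i j) ∈ S) : (fun y => (A y).det) ∈ S := by
  have : (fun y => (A y).det) =
      ∑ σ : Equiv.Perm n, (Equiv.Perm.sign σ : ℤ) • ∏ i, fun y => A y (σ i) i := by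
    ext y
    simp [Matrix.det_apply, Finset.sum_apply, Finset.prod_apply, Units.smul_def]
  rw [this]
  exact sum_mem fun σ _ => zsmul_mem (prod_mem fun i _ => hA _ _) _

theorem det_coordMatrix_mem (β : Basis (N ⊕ C) k Q) {w : Y → N → Q}
    (hw : ∀ (l : Dual k Q) b, (fun y => l (w y b)) ∈ S) :
    (fun y => (coordMatrix β (w y)).det) ∈ S :=
  Subalgebra.det_mem fun b' b => hw (β.coord (Sum.inl b')) b

theorem cramerCoeff_mem (β : Basis (N ⊕ C) k Q) {w : Y → N → Q}
    (hw : ∀ (l : Dual k Q) b, (fun y => l (w y b)) ∈ S) {x : Y → Q}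
    (hx : ∀ l : Dual k Q, (fun y => l (x y)) ∈ S) (b : N) :
    (fun y => cramerCoeff β (w y) (x y) b) ∈ S := by
  simp only [cramerCoeff, Matrix.cramer_apply]
  refine Subalgebra.det_mem fun i j => ?_
  by_cases h : j = b
  · simp only [h, Matrix.updateCol_self]
    exact hx (β.coord (Sum.inl i))
  · simp only [Matrix.updateCol_ne h]
    exact hw (β.coord (Sum.inl i)) j

theorem cramerDefect_mem (β : Basis (N ⊕ C) k Q) {w : Y → N → Q}
    (hw : ∀ (l : Dual k Q) b, (fun y => l (w y b)) ∈ S) {x : Y → Q}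
    (hx : ∀ l : Dual k Q, (fun y => l (x y)) ∈ S) (c : C) :
    (fun y => cramerDefect β (w y) (x y) c) ∈ S := by
  have : (fun y => cramerDefect β (w y) (x y) c) =
      (fun y => (coordMatrix β (w y)).det) * (fun y => β.coord (Sum.inr c) (x y)) -
      ∑ b, (fun y => cramerCoeff β (w y) (x y) b) * fun y => β.coord (Sum.inr c) (w y b) := by
    ext y
    simp [cramerDefect, Finset.sum_apply]
  rw [this]
  exact sub_mem (mul_mem (det_coordMatrix_mem β hw) (hx _))
    (sum_mem fun b _ => mul_mem (cramerCoeff_mem β hw hx b) (hw _ b))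

end Subalgebra

end

section

variable {k V Q : Type} [Field k] [AddCommGroup V] [Module k V] [AddCommGroup Q] [Module k Q]

open scoped Classical in
/-- The number of local equations of `flagLocus`. -/
def equationCount {s r d : ℕ} (q : ℕ) (K : Fin s → Fin d → Fin r)
    (m : ∀ j, {b // b ∉ Set.range (K j)} → ℕ) : ℕ :=
  d * (q - (r - d)) + ∑ j,
    (Fintype.card {p : {b // b ∉ Set.range (K j)} × Fin d // K j p.2 < (p.1 : Fin r)} +
      Fintype.card {p : Fin q × {b // b ∉ Set.range (K j)} // ¬ (p.1 : ℕ) < m j p.2})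

theorem mem_span_spanFlag_iff {q : ℕ} (β : Basis (Fin q) k Q) {x : Q} {m : ℕ} :
    x ∈ span k (β '' {l | (l : ℕ) < m}) ↔ ∀ l : Fin q, ¬ (l : ℕ) < m → β.repr x l = 0 := by
  rw [Basis.mem_span_image]
  constructor
  · intro h l hl
    by_contra h'
    exact hl (h (Finsupp.mem_support_iff.2 h'))
  · intro h l hl
    by_contra h'
    exact Finsupp.mem_support_iff.1 hl (h l h')

theorem map_mem_span_of_finrank_range_le [FiniteDimensional k V] {N : Type} [Fintype N]
    {φ : V →ₗ[k] Q} {v : N → V}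
    (hli : LinearIndependent k fun b => φ (v b)) (h : finrank k (LinearMap.range φ) ≤ Fintype.card N)
    (x : V) : φ x ∈ span k (Set.range fun b => φ (v b)) := by
  have hle : span k (Set.range fun b => φ (v b)) ≤ LinearMap.range φ := by
    rw [span_le]
    rintro _ ⟨b, rfl⟩
    exact ⟨v b, rfl⟩
  rw [Submodule.eq_of_le_of_finrank_le hle (by rwa [finrank_span_eq_card hli])]
  exact ⟨x, rfl⟩

open scoped Classical in
theorem exists_local_equations [FiniteDimensional k V] [FiniteDimensional k Q] {r d s q : ℕ}
    (j₀ : Fin s) (hV : finrank k V = r) (hQ : finrank k Q = q)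
    {K : Fin s → Fin d → Fin r} (hK : ∀ j, Function.Injective (K j))
    {m : ∀ j, {b // b ∉ Set.range (K j)} → ℕ} {e : Fin s → Fin r → V} {f : Fin s → Fin q → Q}
    (he : ∀ j, LinearIndependent k (e j)) (hf : ∀ j, LinearIndependent k (f j))
    {S : Subalgebra k ((V →ₗ[k] Q) → k)}
    (hS : ∀ (l : Dual k Q) v, (fun φ : V →ₗ[k] Q => l (φ v)) ∈ S)
    {φ₀ : V →ₗ[k] Q} (hφ₀ : φ₀ ∈ flagLocus K m e f) :
    ∃ (τ : Type) (_ : Fintype τ) (E : τ → (V →ₗ[k] Q) → k) (D : (V →ₗ[k] Q) → k),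
      Fintype.card τ = equationCount q K m ∧ (∀ i, E i ∈ S) ∧ D ∈ S ∧ (∀ i, E i φ₀ = 0) ∧
      D φ₀ ≠ 0 ∧ ∀ φ, D φ ≠ 0 → (∀ i, E i φ = 0) → φ ∈ flagLocus K m e f := by
  have hcN : ∀ j, Fintype.card {b // b ∉ Set.range (K j)} = r - d := fun j => by
    rw [card_not_range (hK j), Fintype.card_fin, Fintype.card_fin]
  choose β hβ using fun j => exists_basis_sum_extend (hφ₀ j).1
  let F : ∀ j, Basis (Fin q) k Q := fun j =>
    basisOfLinearIndependentOfCardEqFinrank' (f j) (hf j) (by simp [hQ])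
  have hF : ∀ j, ⇑(F j) = f j := fun j => coe_basisOfLinearIndependentOfCardEqFinrank' _ _ _
  let w : ∀ j, (V →ₗ[k] Q) → {b // b ∉ Set.range (K j)} → Q := fun j φ b => φ (e j b)
  let E : (Fin d × Fin (finrank k Q - Fintype.card {b // b ∉ Set.range (K j₀)})) ⊕
      (Σ j, {p : {b // b ∉ Set.range (K j)} × Fin d // K j p.2 < (p.1 : Fin r)} ⊕
        {p : Fin q × {b // b ∉ Set.range (K j)} // ¬ (p.1 : ℕ) < m j p.2}) → (V →ₗ[k] Q) → k :=
    Sum.elim (fun p φ => cramerDefect (β j₀) (w j₀ φ) (φ (e j₀ (K j₀ p.1))) p.2)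
      fun p => Sum.elim
        (fun i φ => cramerCoeff (β p.1) (w p.1 φ) (φ (e p.1 (K p.1 i.1.2))) i.1.1)
        (fun i φ => (F p.1).repr (φ (e p.1 i.1.2)) i.1.1) p.2
  have hw : ∀ j (l : Dual k Q) b, (fun φ => l (w j φ b)) ∈ S := fun j l b => hS l _
  have hspan : ∀ φ j, φ ∈ flagLocus K m e f → ∀ a,
      φ (e j a) ∈ span k (Set.range (w j φ)) := by
    intro φ j hφ a
    refine span_mono ?_ ((hφ j).2.1 a)
    rintro _ ⟨b, hb, rfl⟩
    exact ⟨⟨b, hb.2⟩, rfl⟩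
  have himage : ∀ φ j a, w j φ '' {b | (b : Fin r) ≤ a} =
      (fun a => φ (e j a)) '' {b | b ≤ a ∧ b ∉ Set.range (K j)} := by
    intro φ j a
    ext x
    constructor
    · rintro ⟨b, hb, rfl⟩
      exact ⟨b, ⟨hb, b.2⟩, rfl⟩
    · rintro ⟨b, hb, rfl⟩
      exact ⟨⟨b, hb.2⟩, hb.1, rfl⟩
  have hdet₀ : ∀ j, (coordMatrix (β j) (w j φ₀)).det = 1 := by
    intro j
    have : coordMatrix (β j) (w j φ₀) = 1 := by
      ext b' b
      rw [coordMatrix, Matrix.of_apply, show w j φ₀ b = _ from (hβ j b).symm, Basis.repr_self,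
        Finsupp.single_apply, Matrix.one_apply]
      simp [eq_comm]
    rw [this, Matrix.det_one]
  refine ⟨_, inferInstance, E, fun φ => ∏ j, (coordMatrix (β j) (w j φ)).det, ?_, ?_, ?_, ?_, ?_, ?_⟩
  · simp only [Fintype.card_sum, Fintype.card_prod, Fintype.card_sigma, Fintype.card_fin, hcN, hQ,
      equationCount]
  · rintro (p | ⟨j, p | p⟩)
    · exact cramerDefect_mem _ (hw j₀) (fun l => hS l _) _
    · exact cramerCoeff_mem _ (hw j) (fun l => hS l _) _
    · exact hS ((F j).coord p.1.1) _
  · have : (fun φ => ∏ j, (coordMatrix (β j) (w j φ)).det) =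
        ∏ j, fun φ => (coordMatrix (β j) (w j φ)).det := by
      ext φ; rw [Finset.prod_apply]
    rw [this]
    exact prod_mem fun j _ => det_coordMatrix_mem _ (hw j)
  · have hdet : ∀ j, (coordMatrix (β j) (w j φ₀)).det ≠ 0 := fun j => by simp [hdet₀ j]
    rintro (p | ⟨j, p | p⟩)
    · exact (cramerDefect_eq_zero_iff (hdet j₀)).2 (hspan φ₀ j₀ hφ₀ _) _
    · refine (cramerCoeff_eq_zero_iff (hdet j) (T := {b | (b : Fin r) ≤ K j p.1.2})
        (hspan φ₀ j hφ₀ _)).2 ?_ p.1.1 (not_le.2 p.2)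
      rw [himage]
      exact (hφ₀ j).2.1 _
    · have := (hφ₀ j).2.2 p.1.2
      rw [← hF j] at this
      exact (mem_span_spanFlag_iff (F j)).1 this _ p.2
  · simp [hdet₀]
  · intro φ hD hE
    have hdet : ∀ j, (coordMatrix (β j) (w j φ)).det ≠ 0 := fun j =>
      Finset.prod_ne_zero_iff.1 hD j (Finset.mem_univ j)
    have hli : ∀ j, LinearIndependent k (w j φ) := fun j =>
      linearIndependent_of_det_coordMatrix_ne_zero (hdet j)
    have h₀ : ∀ a, φ (e j₀ a) ∈ span k (Set.range (w j₀ φ)) := by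
      intro a
      by_cases ha : a ∈ Set.range (K j₀)
      · obtain ⟨t, rfl⟩ := ha
        exact (cramerDefect_eq_zero_iff (hdet j₀)).1 fun c => hE (Sum.inl (t, c))
      · exact subset_span ⟨⟨a, ha⟩, rfl⟩
    have hrange : finrank k (LinearMap.range φ) ≤ r - d := by
      have htop : span k (Set.range (e j₀)) = ⊤ :=
        (he j₀).span_eq_top_of_card_eq_finrank' (by simp [hV])
      have hle : LinearMap.range φ ≤ span k (Set.range (w j₀ φ)) := by
        rw [LinearMap.range_eq_map, ← htop, map_span, span_le]
        rintro _ ⟨_, ⟨a, rfl⟩, rfl⟩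
        exact h₀ a
      refine (finrank_mono hle).trans ?_
      rw [finrank_span_eq_card (hli j₀), hcN]
    have hmem : ∀ j x, φ x ∈ span k (Set.range (w j φ)) := fun j x =>
      map_mem_span_of_finrank_range_le (hli j) (by rwa [hcN]) x
    refine fun j => ⟨hli j, fun a => ?_, fun b => ?_⟩
    · by_cases ha : a ∈ Set.range (K j)
      · obtain ⟨t, rfl⟩ := ha
        rw [← himage]
        refine (cramerCoeff_eq_zero_iff (hdet j) (hmem j _)).1 fun b hb => ?_
        exact hE (Sum.inr ⟨j, Sum.inl ⟨(b, t), not_le.1 hb⟩⟩)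
      · exact subset_span ⟨a, ⟨le_rfl, ha⟩, rfl⟩
    · rw [← hF j, mem_span_spanFlag_iff]
      exact fun l hl => hE (Sum.inr ⟨j, Sum.inr ⟨(l, b), hl⟩⟩)

end

section Counting

variable {s r d q : ℕ} {K : Fin s → Fin d → Fin r}

open scoped Classical in
theorem paramCount_add_equationCount (hdr : d ≤ r) (hq : r - d ≤ q)
    (hK : ∀ j, Function.Injective (K j)) (m : ∀ j, {b // b ∉ Set.range (K j)} → ℕ) :
    paramCount q K m + equationCount q K m = s * (r * r + q * q) + r * q := by
  have hcN : ∀ j, Fintype.card {b // b ∉ Set.range (K j)} = r - d := fun j => by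
    rw [card_not_range (hK j), Fintype.card_fin, Fintype.card_fin]
  have hA : ∀ j, Fintype.card {p : {b // b ∉ Set.range (K j)} × Fin d // (p.1 : Fin r) < K j p.2} +
      Fintype.card {p : {b // b ∉ Set.range (K j)} × Fin d // K j p.2 < (p.1 : Fin r)} =
      (r - d) * d := by
    intro j
    have h1 : Fintype.card {p : {b // b ∉ Set.range (K j)} × Fin d // K j p.2 < (p.1 : Fin r)} =
        Fintype.card {p : {b // b ∉ Set.range (K j)} × Fin d // ¬ (p.1 : Fin r) < K j p.2} := by
      refine Fintype.card_congr (Equiv.subtypeEquivRight fun p => ?_)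
      rw [not_lt]
      exact ⟨le_of_lt, fun h => lt_of_le_of_ne h fun h' => p.1.2 ⟨p.2, h'⟩⟩
    have h2 := Fintype.card_subtype_compl
      (fun p : {b // b ∉ Set.range (K j)} × Fin d => (p.1 : Fin r) < K j p.2)
    have h3 := Fintype.card_subtype_le
      (fun p : {b // b ∉ Set.range (K j)} × Fin d => (p.1 : Fin r) < K j p.2)
    rw [Fintype.card_prod, hcN, Fintype.card_fin] at h2 h3
    omega
  have hB : ∀ j, Fintype.card {p : Fin q × {b // b ∉ Set.range (K j)} // (p.1 : ℕ) < m j p.2} +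
      Fintype.card {p : Fin q × {b // b ∉ Set.range (K j)} // ¬ (p.1 : ℕ) < m j p.2} =
      q * (r - d) := by
    intro j
    have h2 := Fintype.card_subtype_compl
      (fun p : Fin q × {b // b ∉ Set.range (K j)} => (p.1 : ℕ) < m j p.2)
    have h3 := Fintype.card_subtype_le
      (fun p : Fin q × {b // b ∉ Set.range (K j)} => (p.1 : ℕ) < m j p.2)
    rw [Fintype.card_prod, hcN, Fintype.card_fin] at h2 h3
    omega
  obtain ⟨ρ, rfl⟩ := Nat.exists_eq_add_of_le hdr
  simp only [Nat.add_sub_cancel_left] at hA hB hq ⊢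
  obtain ⟨σ, rfl⟩ := Nat.exists_eq_add_of_le hq
  simp only [paramCount, equationCount, Nat.add_sub_cancel_left]
  have hsum : ∀ j, ((d + ρ) * ρ +
      (Fintype.card {p : {b // b ∉ Set.range (K j)} × Fin d // (p.1 : Fin (d + ρ)) < K j p.2} +
        d * d) +
      (Fintype.card {p : Fin (ρ + σ) × {b // b ∉ Set.range (K j)} // (p.1 : ℕ) < m j p.2} +
        (ρ + σ) * σ)) +
      (Fintype.card {p : {b // b ∉ Set.range (K j)} × Fin d // K j p.2 < (p.1 : Fin (d + ρ))} +
      Fintype.card {p : Fin (ρ + σ) × {b // b ∉ Set.range (K j)} // ¬ (p.1 : ℕ) < m j p.2}) =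
      (d + ρ) * (d + ρ) + (ρ + σ) * (ρ + σ) := by
    intro j
    have h1 := hA j
    have h2 := hB j
    zify at h1 h2 ⊢
    linear_combination h1 + h2
  have := Finset.sum_congr (rfl : (Finset.univ : Finset (Fin s)) = Finset.univ) fun j _ => hsum j
  rw [Finset.sum_add_distrib, Finset.sum_const, Finset.card_univ, Fintype.card_fin,
    smul_eq_mul] at this
  zify at this ⊢
  linear_combination this

open scoped Classical in
theorem card_lt_not_range {K : Fin d → Fin r} (hK : StrictMono K) (hdr : d ≤ r) (t : Fin d) :
    Fintype.card {b : {b // b ∉ Set.range K} // K t < (b : Fin r)} = (r - d + t) - K t := by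
  have h1 := card_filter_range_add hK.injective (u := (K t : ℕ) + 1) (K t).2
  have h2 : (Finset.univ.filter fun a : Fin d => (K a : ℕ) + 1 ≤ (K t : ℕ) + 1).card = t + 1 := by
    rw [← card_filter_val_lt (r := d) (u := (t : ℕ) + 1) t.2]
    congr 1
    ext a
    simp only [Finset.mem_filter, Finset.mem_univ, true_and, add_le_add_iff_right,
      Nat.lt_succ_iff]
    exact hK.le_iff_le
  have h3 : (Finset.univ.filter fun b : Fin r => b ∈ {b | b ∉ Set.range K} ∧
      (b : ℕ) < (K t : ℕ) + 1).card =
      Fintype.card {b : {b // b ∉ Set.range K} // ¬ K t < (b : Fin r)} := by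
    rw [← Fintype.card_subtype]
    refine Fintype.card_congr ((Equiv.subtypeSubtypeEquivSubtypeInter _ _).symm.trans
      (Equiv.subtypeEquivRight fun b => ?_))
    rw [not_lt, Fin.le_def, Nat.lt_succ_iff]
  have h4 := Fintype.card_subtype_compl (fun b : {b // b ∉ Set.range K} => K t < (b : Fin r))
  have h5 := Fintype.card_subtype_le (fun b : {b // b ∉ Set.range K} => K t < (b : Fin r))
  rw [card_not_range hK.injective, Fintype.card_fin, Fintype.card_fin] at h4 h5
  omega

theorem card_not_val_lt {m : ℕ} : Fintype.card {l : Fin q // ¬ (l : ℕ) < m} = q - m := by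
  by_cases hm : m ≤ q
  · have := Fintype.card_subtype_compl (fun l : Fin q => (l : ℕ) < m)
    rw [this, Fintype.card_subtype, card_filter_val_lt hm, Fintype.card_fin]
  · have : IsEmpty {l : Fin q // ¬ (l : ℕ) < m} := ⟨fun l => l.2 (by have := l.1.2; omega)⟩
    rw [Fintype.card_eq_zero]
    omega

theorem val_le_of_strictMono {n : ℕ} {i : Fin r → Fin n} (hi : StrictMono i) (a : Fin r) :
    (a : ℕ) ≤ i a := by
  obtain ⟨a, ha⟩ := a
  induction a with
  | zero => exact Nat.zero_le _
  | succ a ih =>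
    have h1 := ih (by omega)
    have h2 : (i ⟨a, by omega⟩ : ℕ) < i ⟨a + 1, ha⟩ := hi (Fin.mk_lt_mk.2 (Nat.lt_succ_self a))
    simp only at h1 h2 ⊢
    omega

open scoped Classical in
theorem equationCount_eq {n : ℕ} (hdr : d ≤ r) (hq : r - d ≤ n - r)
    {I : Fin s → Fin r → Fin n} (hI : ∀ j, StrictMono (I j)) (hK : ∀ j, StrictMono (K j)) :
    equationCount (n - r) K (fun j b => (I j b : ℕ) - (b : Fin r)) + d * (r - d) +
      ∑ j : Fin s, ∑ t : Fin d, ((n - r + (K j t : ℕ)) - (I j (K j t) : ℕ)) =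
    (∑ j, codimN n r (I j)) + (∑ j, codimN r d (K j)) + d * (n - r) := by
  have h1 : ∀ j, Fintype.card
      {p : {b // b ∉ Set.range (K j)} × Fin d // K j p.2 < (p.1 : Fin r)} = codimN r d (K j) := by
    intro j
    rw [Fintype.card_congr (((Equiv.prodComm _ _).subtypeEquivOfSubtype' ).trans
      (Equiv.subtypeProdEquivSigmaSubtype fun (t : Fin d) (b : {b // b ∉ Set.range (K j)}) =>
        K j t < (b : Fin r))), Fintype.card_sigma, codimN]
    exact Finset.sum_congr rfl fun t _ => card_lt_not_range (hK j) hdr t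
  have h2 : ∀ j, Fintype.card {p : Fin (n - r) × {b // b ∉ Set.range (K j)} //
      ¬ (p.1 : ℕ) < (I j p.2 : ℕ) - (p.2 : Fin r)} +
      ∑ t : Fin d, ((n - r + (K j t : ℕ)) - (I j (K j t) : ℕ)) = codimN n r (I j) := by
    intro j
    rw [codimN, ← sum_range_add_sum_not_range (hK j).injective, add_comm]
    congr 1
    rw [Fintype.card_congr (((Equiv.prodComm _ _).subtypeEquivOfSubtype').trans
      (Equiv.subtypeProdEquivSigmaSubtype fun (b : {b // b ∉ Set.range (K j)}) (l : Fin (n - r)) =>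
        ¬ (l : ℕ) < (I j b : ℕ) - (b : Fin r))), Fintype.card_sigma]
    refine Finset.sum_congr rfl fun b _ => ?_
    rw [card_not_val_lt]
    have := val_le_of_strictMono (hI j) b
    omega
  obtain ⟨ρ, hρ⟩ := Nat.exists_eq_add_of_le hdr
  obtain ⟨σ, hσ⟩ := Nat.exists_eq_add_of_le hq
  have h3 : d * (n - r) = d * ((n - r) - (r - d)) + d * (r - d) := by
    rw [← mul_add]; congr 1; omega
  simp only [equationCount, h1]
  rw [h3, ← Finset.sum_congr rfl fun j _ => h2 j, Finset.sum_add_distrib, Finset.sum_add_distrib]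
  ring

end Counting

section Components

variable {k V Q : Type} [Field k] [AddCommGroup V] [Module k V] [AddCommGroup Q] [Module k Q]

theorem mem_range_aeval_coord {M ι : Type} [AddCommGroup M] [Module k M] [Fintype ι]
    (B : Basis ι k M) (L : Dual k M) :
    (fun x => L x) ∈ (MvPolynomial.aeval (R := k) fun i (x : M) => B.repr x i).range := by
  refine ⟨∑ i, MvPolynomial.C (L (B i)) * MvPolynomial.X i, funext fun x => ?_⟩
  conv_rhs => rw [← B.sum_repr x]
  simp [-Basis.sum_repr, mul_comm]

theorem aeval_coord_apply {M ι : Type} [AddCommGroup M] [Module k M]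
    (B : Basis ι k M) (p : MvPolynomial ι k) (x : M) :
    MvPolynomial.aeval (R := k) (fun i (x : M) => B.repr x i) p x =
      MvPolynomial.eval (fun i => B.repr x i) p := by
  have := MvPolynomial.comp_aeval_apply (fun i (x : M) => B.repr x i)
    (Pi.evalAlgHom k (fun _ : M => k) x) p
  rw [← MvPolynomial.aeval_eq_eval]
  exact this

theorem WithBot.eq_natCast_of_lt_natCast {D : WithBot ℕ∞} {m n a : ℕ} (hub : D < m)
    (hlb : (n : WithBot ℕ∞) ≤ D + a) : ∃ b : ℕ, D = b := by
  induction D with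
  | bot =>
    rw [WithBot.bot_add, le_bot_iff] at hlb
    exact absurd hlb (WithBot.natCast_ne_bot n)
  | coe D =>
    induction D with
    | top => exact absurd (WithBot.coe_lt_coe.1 hub) not_top_lt
    | coe D => exact ⟨D, rfl⟩

theorem card_le_krullDim_component_flagLocus [IsAlgClosed k] [FiniteDimensional k V]
    [FiniteDimensional k Q] {r d s q : ℕ} (hs : 0 < s) (hV : finrank k V = r)
    (hQ : finrank k Q = q) {K : Fin s → Fin d → Fin r} (hK : ∀ j, Function.Injective (K j))
    {m : ∀ j, {b // b ∉ Set.range (K j)} → ℕ} {e : Fin s → Fin r → V} {f : Fin s → Fin q → Q}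
    (he : ∀ j, LinearIndependent k (e j)) (hf : ∀ j, LinearIndependent k (f j))
    {C : Set (flagLocus K m e f)}
    (hC : C ∈ subComponents (mZariski k (V →ₗ[k] Q)) (flagLocus K m e f)) :
    ((r * q : ℕ) : WithBot ℕ∞) ≤ compDim (mZariski k (V →ₗ[k] Q)) (flagLocus K m e f) C +
      ((equationCount q K m : ℕ) : WithBot ℕ∞) := by
  classical
  let B := (finBasisOfFinrankEq k V hV).linearMap (finBasisOfFinrankEq k Q hQ)
  let := mZariski k (V →ₗ[k] Q)
  have hB := isZariskiCoord_mZariski B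
  have hcard : Nat.card (Fin q × Fin r) = r * q := by simp [mul_comm]
  rw [← hcard]
  refine hB.card_le_topologicalKrullDim_add (fun y => ⟨B.equivFun.symm y, funext fun i => ?_⟩)
    (fun φ₀ hφ₀ => ?_) hC
  · exact congrFun (B.equivFun.apply_symm_apply y) i
  obtain ⟨τ, _, E, D, hτ, hE, hD, hE₀, hD₀, H⟩ := exists_local_equations ⟨0, hs⟩ hV hQ hK he hf
    (fun l v => mem_range_aeval_coord B (l ∘ₗ LinearMap.applyₗ v)) hφ₀
  choose P hP using hE
  obtain ⟨g, rfl⟩ := hD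
  have hP' : ∀ i φ, MvPolynomial.eval (fun l => B.repr φ l) (P i) = E i φ := fun i φ => by
    rw [← aeval_coord_apply, ← hP]
    rfl
  refine ⟨Set.range P, g, ?_, ?_, ?_, fun φ hg hφ => H φ ?_ fun i => ?_⟩
  · rw [← hτ, ← Set.image_univ]
    refine (Set.encard_image_le _ _).trans ?_
    simp [Set.encard_univ]
  · rintro _ ⟨i, rfl⟩
    exact (hP' i φ₀).trans (hE₀ i)
  · rw [← aeval_coord_apply]
    exact hD₀
  · rw [← aeval_coord_apply] at hg
    exact hg
  · rw [← hP']
    exact hφ _ ⟨i, rfl⟩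

theorem krullDim_component_lt {bV : Basis (Fin r) k V} {bQ : Basis (Fin q) k Q} {M : ℕ}
    {A : Set (V →ₗ[k] Q)}
    (H : ∀ J : Fin M → Fin q × Fin r, ∃ R : MvPolynomial (Fin M) k, R ≠ 0 ∧ ∀ φ ∈ A,
      MvPolynomial.eval (fun i => LinearMap.toMatrix bV bQ φ (J i).1 (J i).2) R = 0) (C : Set A) :
    compDim (mZariski k (V →ₗ[k] Q)) A C < M := by
  classical
  let B := bV.linearMap bQ
  let := mZariski k (V →ₗ[k] Q)
  have hB := ((isZariskiCoord_mZariski B).subtype A).subtype C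
  refine hB.topologicalKrullDim_lt fun J => ?_
  obtain ⟨R, hR, h⟩ := H J
  refine ⟨R, hR, fun x => ?_⟩
  rw [← h x.1 x.1.2]
  congr 1

/-- Outside a hypersurface of tuples of bases, all components of `flagLocus` have the
dimension given by the count of local equations. -/
theorem exists_generic_compDim_flagLocus [IsAlgClosed k] [FiniteDimensional k V]
    [FiniteDimensional k Q] {r d s q : ℕ} (hs : 0 < s) (hdr : d ≤ r)
    (bV : Basis (Fin r) k V) (bQ : Basis (Fin q) k Q)
    {K : Fin s → Fin d → Fin r} (hK : ∀ j, Function.Injective (K j))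
    (m : ∀ j, {b // b ∉ Set.range (K j)} → ℕ) :
    ∃ c : MvPolynomial ((Fin s × Fin r × Fin r) ⊕ (Fin s × Fin q × Fin q)) k, c ≠ 0 ∧
      ∀ (e : Fin s → Fin r → V) (f : Fin s → Fin q → Q), (∀ j, LinearIndependent k (e j)) →
        (∀ j, LinearIndependent k (f j)) →
        MvPolynomial.eval (Sum.elim (fun i => bV.repr (e i.1 i.2.2) i.2.1)
          (fun i => bQ.repr (f i.1 i.2.2) i.2.1)) c ≠ 0 →
        ∀ C ∈ subComponents (mZariski k (V →ₗ[k] Q)) (flagLocus K m e f), r - d ≤ q ∧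
          ∃ D : ℕ, compDim (mZariski k (V →ₗ[k] Q)) (flagLocus K m e f) C = D ∧
            D + equationCount q K m = r * q := by
  classical
  have hV : finrank k V = r := by simp [finrank_eq_card_basis bV]
  have hQ : finrank k Q = q := by simp [finrank_eq_card_basis bQ]
  obtain ⟨c, hc, H⟩ := exists_generic_relation_flagLocus hs hdr hK m bV bQ
    (M := paramCount q K m + 1 - s * (r * r + q * q)) (by omega)
  refine ⟨c, hc, fun e f he hf hcef C hC => ?_⟩
  have hlb := card_le_krullDim_component_flagLocus hs hV hQ hK he hf hC
  have hub := krullDim_component_lt (H e f he hcef) C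
  have hq : r - d ≤ q := by
    let := mZariski k (V →ₗ[k] Q)
    have hC' : C ∈ irreducibleComponents (flagLocus K m e f) := hC
    obtain ⟨φ, -⟩ := hC'.1.1
    have h := (φ.2 ⟨0, hs⟩).1.fintype_card_le_finrank
    rwa [card_not_range (hK _), Fintype.card_fin, Fintype.card_fin, hQ] at h
  have hcount := paramCount_add_equationCount hdr hq hK m
  obtain ⟨D, hD⟩ := WithBot.eq_natCast_of_lt_natCast hub hlb
  rw [hD] at hlb hub
  rw [← Nat.cast_add, Nat.cast_le] at hlb
  rw [Nat.cast_lt] at hub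
  exact ⟨hq, D, hD, by omega⟩

end Components

section Generic

variable {k V Q : Type} [Field k] [AddCommGroup V] [Module k V] [AddCommGroup Q] [Module k Q]

theorem MvPolynomial.exists_eval_ne_zero_and_isUnit_det [Infinite k] {s r q : ℕ}
    {c : MvPolynomial ((Fin s × Fin r × Fin r) ⊕ (Fin s × Fin q × Fin q)) k} (hc : c ≠ 0) :
    ∃ (a : Fin s → Matrix (Fin r) (Fin r) k) (b : Fin s → Matrix (Fin q) (Fin q) k),
      MvPolynomial.eval (Sum.elim (fun i => a i.1 i.2.1 i.2.2) (fun i => b i.1 i.2.1 i.2.2)) c ≠ 0 ∧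
        (∀ j, IsUnit (a j)) ∧ ∀ j, IsUnit (b j) := by
  classical
  let δ : MvPolynomial ((Fin s × Fin r × Fin r) ⊕ (Fin s × Fin q × Fin q)) k :=
    (∏ j, Matrix.det (Matrix.of fun i l => MvPolynomial.X (Sum.inl (j, i, l)))) *
      ∏ j, Matrix.det (Matrix.of fun i l => MvPolynomial.X (Sum.inr (j, i, l)))
  have hev : ∀ (a : Fin s → Matrix (Fin r) (Fin r) k) (b : Fin s → Matrix (Fin q) (Fin q) k),
      MvPolynomial.eval (Sum.elim (fun i => a i.1 i.2.1 i.2.2) (fun i => b i.1 i.2.1 i.2.2)) δ =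
        (∏ j, (a j).det) * ∏ j, (b j).det := by
    intro a b
    simp only [δ, map_mul, map_prod, RingHom.map_det]
    congr! 4 <;> ext <;> simp
  have hδ : δ ≠ 0 := by
    intro h
    have := hev 1 1
    simp [h] at this
  have hne : c * δ ≠ 0 := mul_ne_zero hc hδ
  obtain ⟨y, hy⟩ : ∃ y, MvPolynomial.eval y (c * δ) ≠ 0 := by
    by_contra! h
    exact hne (MvPolynomial.funext fun y => by simpa using h y)
  let a : Fin s → Matrix (Fin r) (Fin r) k := fun j i l => y (Sum.inl (j, i, l))
  let b : Fin s → Matrix (Fin q) (Fin q) k := fun j i l => y (Sum.inr (j, i, l))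
  have hyab : y = Sum.elim (fun i => a i.1 i.2.1 i.2.2) (fun i => b i.1 i.2.1 i.2.2) := by
    funext x
    rcases x with x | x <;> rfl
  rw [map_mul, hyab, hev] at hy
  have h2 := right_ne_zero_of_mul hy
  refine ⟨a, b, left_ne_zero_of_mul hy, fun j => ?_, fun j => ?_⟩ <;>
    rw [Matrix.isUnit_iff_isUnit_det, isUnit_iff_ne_zero]
  · exact Finset.prod_ne_zero_iff.1 (left_ne_zero_of_mul h2) j (Finset.mem_univ j)
  · exact Finset.prod_ne_zero_iff.1 (right_ne_zero_of_mul h2) j (Finset.mem_univ j)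

theorem Module.Basis.linearIndependent_of_isUnit {ι : Type} [Fintype ι] [DecidableEq ι]
    (B : Basis ι k V) {a : Matrix ι ι k} (ha : IsUnit a) :
    LinearIndependent k fun l => B.equivFun.symm (fun i => a i l) := by
  refine LinearIndependent.map' ?_ B.equivFun.symm.toLinearMap (LinearEquiv.ker _)
  exact Matrix.linearIndependent_cols_iff_isUnit.2 ha

theorem genericFlagPairs_of_eval_ne_zero [Infinite k] {s r q : ℕ}
    (bV : Basis (Fin r) k V) (bQ : Basis (Fin q) k Q)
    {c : MvPolynomial ((Fin s × Fin r × Fin r) ⊕ (Fin s × Fin q × Fin q)) k} (hc : c ≠ 0)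
    {P : (Fin s → ℕ → Submodule k V) → (Fin s → ℕ → Submodule k Q) → Prop}
    (H : ∀ (e : Fin s → Fin r → V) (f : Fin s → Fin q → Q), (∀ j, LinearIndependent k (e j)) →
      (∀ j, LinearIndependent k (f j)) →
      MvPolynomial.eval (Sum.elim (fun i => bV.repr (e i.1 i.2.2) i.2.1)
        (fun i => bQ.repr (f i.1 i.2.2) i.2.1)) c ≠ 0 →
      P (fun j => spanFlag k (e j)) (fun j => spanFlag k (f j))) :
    GenericFlagPairs k s r q P := by
  classical
  let χ : (Fin s × Fin r × Fin r) ⊕ (Fin s × Fin q × Fin q) →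
      Dual k ((Fin s → Fin r → V) × (Fin s → Fin q → Q)) :=
    Sum.elim
      (fun i => bV.coord i.2.1 ∘ₗ LinearMap.proj i.2.2 ∘ₗ LinearMap.proj i.1 ∘ₗ
        LinearMap.fst k _ _)
      (fun i => bQ.coord i.2.1 ∘ₗ LinearMap.proj i.2.2 ∘ₗ LinearMap.proj i.1 ∘ₗ
        LinearMap.snd k _ _)
  have hχ : ∀ b, mEval k b (MvPolynomial.rename χ c) =
      MvPolynomial.eval (Sum.elim (fun i => bV.repr (b.1 i.1 i.2.2) i.2.1)
        (fun i => bQ.repr (b.2 i.1 i.2.2) i.2.1)) c := fun b => by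
    rw [mEval, MvPolynomial.eval_rename]
    congr 2
    funext i
    rcases i with i | i <;> rfl
  refine ⟨{b | mEval k b (MvPolynomial.rename χ c) ≠ 0},
    TopologicalSpace.isOpen_generateFrom_of_mem ⟨_, rfl⟩, ?_, fun b hb hli => ?_⟩
  · obtain ⟨a, b, hab, ha, hb⟩ := MvPolynomial.exists_eval_ne_zero_and_isUnit_det hc
    refine ⟨(fun j l => bV.equivFun.symm fun i => a j i l,
      fun j l => bQ.equivFun.symm fun i => b j i l), ?_,
      fun j => bV.linearIndependent_of_isUnit (ha j),
      fun j => bQ.linearIndependent_of_isUnit (hb j)⟩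
    rw [Set.mem_ofPred_eq, hχ]
    simpa only [← Basis.equivFun_apply, LinearEquiv.apply_symm_apply] using hab
  · exact H b.1 b.2 hli.1 hli.2 (by rw [← hχ]; exact hb)

end Generic

/-- Proposition `strong` (2).  There is a nonempty open subset `U`
of `Fl(V)^s × Fl(Q)^s` such that for `(𝓕,𝓖) ∈ U` every irreducible component of
`{φ ∈ Hom_𝓘(V,Q,𝓕,𝓖) : dim ker φ = d, ker φ ∈ ∩_j Ω°_{K^j}(F^j_•)}` has dimension
`[dim Gr(r,n) - ∑_j codim ω_{I^j}] + [dim Gr(d,r) - ∑_j codim ω_{K^j}]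
 + [∑_j ∑_{a∈K^j}(n-r+a-i^j_a) - d(n-r)]`
(stated additively: `dim C + ∑_j codim ω_{I^j} + ∑_j codim ω_{K^j} + d(n-r)
 = r(n-r) + d(r-d) + ∑_j ∑_{a∈K^j}(n-r+a-i^j_a)`). -/
theorem stmt15 (k : Type) [Field k] [IsAlgClosed k]
    {V Q : Type} [AddCommGroup V] [Module k V] [FiniteDimensional k V]
    [AddCommGroup Q] [Module k Q] [FiniteDimensional k Q]
    (n r d s : ℕ) (hs : 0 < s) (hrn : r ≤ n) (hdr : d ≤ r)
    (hV : Module.finrank k V = r) (hQ : Module.finrank k Q = n - r)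
    (I : Fin s → Fin r → Fin n) (hI : ∀ j, StrictMono (I j))
    (K : Fin s → Fin d → Fin r) (hK : ∀ j, StrictMono (K j)) :
    GenericFlagPairs k (M := V) (Q := Q) s r (n - r) (fun F G =>
      ∀ C ∈ subComponents (mZariski k (V →ₗ[k] Q))
          {φ : V →ₗ[k] Q | φ ∈ homSpace I F G ∧
            Module.finrank k ↥(LinearMap.ker φ) = d ∧
            ∀ j, cellMem (K j) (F j) (LinearMap.ker φ)},
        compDim (mZariski k (V →ₗ[k] Q))
            {φ : V →ₗ[k] Q | φ ∈ homSpace I F G ∧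
              Module.finrank k ↥(LinearMap.ker φ) = d ∧
              ∀ j, cellMem (K j) (F j) (LinearMap.ker φ)} C
          + (((∑ j : Fin s, codimN n r (I j)) + (∑ j : Fin s, codimN r d (K j))
              + d * (n - r) : ℕ) : WithBot ℕ∞)
        = ((r * (n - r) + d * (r - d)
            + ∑ j : Fin s, ∑ t : Fin d, ((n - r + (K j t : ℕ)) - (I j (K j t) : ℕ))
              : ℕ) : WithBot ℕ∞)) := by
  have hK' := fun j => (hK j).injective
  let bV := finBasisOfFinrankEq k V hV
  let bQ := finBasisOfFinrankEq k Q hQ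
  obtain ⟨c, hc, H⟩ := exists_generic_compDim_flagLocus hs hdr bV bQ hK'
    (fun j b => (I j b : ℕ) - (b : Fin r))
  refine genericFlagPairs_of_eval_ne_zero bV bQ hc fun e f he hf hcef => ?_
  rw [show {φ : V →ₗ[k] Q | φ ∈ homSpace I (fun j => spanFlag k (e j)) (fun j => spanFlag k (f j)) ∧
      finrank k (LinearMap.ker φ) = d ∧
      ∀ j, cellMem (K j) (spanFlag k (e j)) (LinearMap.ker φ)} =
      flagLocus K (fun j b => (I j b : ℕ) - (b : Fin r)) e f from
    Set.ext fun φ => mem_locus_iff hs hV hI hK' he f φ]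
  intro C hC
  obtain ⟨hq, D, hD, hdim⟩ := H e f he hf hcef C hC
  have hcount := equationCount_eq hdr hq hI hK
  rw [hD, ← Nat.cast_add, Nat.cast_inj]
  omega

end
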